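/- arXiv:1704.08182 — 5 statements merged into one kernel-verified Lean document; each statement's English description precedes it below -/
import Mathlib

section
/- Fix $m\ge 2$, $n\ge 1$, a finite set $W$, and $T\ge 0$. Let $D\subseteq(\mathbb{Z}/m\mathbb{Z})^n$ be finite, let $P,Q$ be probability distributions on $D$ with point probabilities $p_x,q_y$, and let $U_0,\dots,U_T$ be unitaries on $H=\mathbb{C}^{(\mathbb{Z}/m\mathbb{Z})\times\{0,\dots,n\}\times W}$; for $x\in D$ set $\psi_x = U_T O_x U_{T-1} O_x\cdots U_1 O_x U_0|0\rangle$. Let $\Pi_0,\Pi_1$ be orthogonal projections on $H$ with $\Pi_0+\Pi_1=I$, and set $s_P=\sum_{x\in D}p_x\|\Pi_1\psi_x\|^2$ and $s_Q=\sum_{y\in D}q_y\|\Pi_1\psi_y\|^2$. Then for every real $D\times D$ matrix $\Gamma$: $\delta_P^{\mathsf{T}}\Gamma\,\delta_Q \;\le\; \tau(s_P,s_Q)\,\|\Gamma\| \;+\; 2T\,\max_{1\le j\le n}\|\Gamma\circ\Delta_j\|$. -/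
noncomputable section

/-- The spectral norm (largest singular value) of a real matrix. -/
def specNorm {α β : Type*} [Fintype α] [Fintype β] [DecidableEq β]
    (A : Matrix α β ℝ) : ℝ :=
  ‖LinearMap.toContinuousLinearMap (Matrix.toEuclideanLin A)‖

/-- Index set of the state space: `(ℤ/mℤ) × {0,…,n} × W`. -/
abbrev QIdx (m n : ℕ) (W : Type) : Type := ZMod m × Fin (n + 1) × W

/-- The Hilbert space `H = ℂ^{(ℤ/mℤ) × {0,…,n} × W}`. -/
abbrev QSpace (m n : ℕ) (W : Type) : Type := EuclideanSpace ℂ (QIdx m n W)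

/-- Extension of an input string `x : {1,…,n} → ℤ/mℤ` to the index `0` (no shift). -/
def xExt {m n : ℕ} (x : Fin n → ZMod m) : Fin (n + 1) → ZMod m :=
  Fin.cases 0 x

/-- The permutation of basis indices underlying the oracle `O_x`:
`(a, i, w) ↦ (a + x_i, i, w)` (with `x_0 = 0`). -/
def oracleEquiv {m n : ℕ} (W : Type) (x : Fin n → ZMod m) :
    QIdx m n W ≃ QIdx m n W where
  toFun p := (p.1 + xExt x p.2.1, p.2)
  invFun p := (p.1 - xExt x p.2.1, p.2)
  left_inv p := by simp
  right_inv p := by simp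

/-- The oracle unitary `O_x` on `H`, sending the standard basis vector `|a,i,w⟩` to
`|a + x_i, i, w⟩` for `1 ≤ i ≤ n` and fixing `|a,0,w⟩`. -/
def oracle (m n : ℕ) [NeZero m] (W : Type) [Fintype W] (x : Fin n → ZMod m) :
    QSpace m n W ≃ₗᵢ[ℂ] QSpace m n W :=
  LinearIsometryEquiv.piLpCongrLeft 2 ℂ ℂ (oracleEquiv W x)

/-- The state of the algorithm after `t` queries:
`stateAfter U Ox ψ₀ t = U_t O_x U_{t-1} O_x ⋯ U_1 O_x U_0 ψ₀`. -/
def stateAfter (m n : ℕ) [NeZero m] (W : Type) [Fintype W]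
    (U : ℕ → QSpace m n W ≃ₗᵢ[ℂ] QSpace m n W)
    (Ox : QSpace m n W ≃ₗᵢ[ℂ] QSpace m n W) (ψ0 : QSpace m n W) : ℕ → QSpace m n W
  | 0 => U 0 ψ0
  | t + 1 => U (t + 1) (Ox (stateAfter m n W U Ox ψ0 t))

lemma aux_bilin {α : Type*} [Fintype α] [DecidableEq α] (A : Matrix α α ℝ) (a b : α → ℝ) :
    ∑ x, ∑ y, A x y * (a x * b y) ≤
      specNorm A * (Real.sqrt (∑ x, a x ^ 2) * Real.sqrt (∑ y, b y ^ 2)) := by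
  have h1 := real_inner_le_norm (WithLp.toLp 2 a : EuclideanSpace ℝ α)
    (Matrix.toEuclideanLin A (WithLp.toLp 2 b))
  have h2 := (LinearMap.toContinuousLinearMap (Matrix.toEuclideanLin A)).le_opNorm
    (WithLp.toLp 2 b)
  have ha : ‖(WithLp.toLp 2 a : EuclideanSpace ℝ α)‖ = Real.sqrt (∑ x, a x ^ 2) := by
    simp [EuclideanSpace.norm_eq]
  have hb : ‖(WithLp.toLp 2 b : EuclideanSpace ℝ α)‖ = Real.sqrt (∑ x, b x ^ 2) := by
    simp [EuclideanSpace.norm_eq]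
  have h3 : inner ℝ (WithLp.toLp 2 a : EuclideanSpace ℝ α)
    (Matrix.toEuclideanLin A (WithLp.toLp 2 b)) = ∑ x, ∑ y, A x y * (a x * b y) := by
    simp only [PiLp.inner_apply, Matrix.toLpLin_toLp, Matrix.toLin'_apply, Matrix.mulVec,
      dotProduct, RCLike.inner_apply, conj_trivial, Finset.sum_mul]
    refine Finset.sum_congr rfl fun x _ => Finset.sum_congr rfl fun y _ => by ring
  rw [h3] at h1
  rw [ha] at h1
  rw [hb] at h2
  have h4 := mul_le_mul_of_nonneg_left h2 (Real.sqrt_nonneg (∑ x, a x ^ 2))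
  refine h1.trans (h4.trans (le_of_eq ?_))
  unfold specNorm
  ring

lemma aux_bilin_sum {α K : Type*} [Fintype α] [DecidableEq α] [Fintype K]
    (A : Matrix α α ℝ) (a b : α → K → ℝ) :
    ∑ x, ∑ y, A x y * (∑ k, a x k * b y k) ≤
      specNorm A * (Real.sqrt (∑ x, ∑ k, a x k ^ 2) * Real.sqrt (∑ y, ∑ k, b y k ^ 2)) := by
  have h0 : 0 ≤ specNorm A := norm_nonneg _
  have h1 : ∑ x, ∑ y, A x y * (∑ k, a x k * b y k)
      = ∑ k, ∑ x, ∑ y, A x y * (a x k * b y k) := by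
    rw [Finset.sum_comm (s := (Finset.univ : Finset K))]
    refine Finset.sum_congr rfl fun x _ => ?_
    rw [Finset.sum_comm (s := (Finset.univ : Finset K))]
    refine Finset.sum_congr rfl fun y _ => ?_
    rw [Finset.mul_sum]
  rw [h1]
  refine (Finset.sum_le_sum fun k _ => aux_bilin A (fun x => a x k) (fun y => b y k)).trans ?_
  rw [← Finset.mul_sum]
  refine mul_le_mul_of_nonneg_left ?_ h0
  refine (Real.sum_mul_le_sqrt_mul_sqrt _ _ _).trans (le_of_eq ?_)
  have e : ∀ c : α → K → ℝ, ∑ k, Real.sqrt (∑ x, c x k ^ 2) ^ 2 = ∑ x, ∑ k, c x k ^ 2 := by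
    intro c
    rw [Finset.sum_comm]
    exact Finset.sum_congr rfl fun k _ =>
      Real.sq_sqrt (Finset.sum_nonneg fun x _ => sq_nonneg _)
  rw [e, e]

lemma aux_inner {K : Type*} [Fintype K] (u v : EuclideanSpace ℂ K) :
    (inner ℂ u v).re = ∑ k : K ⊕ K,
      (Sum.elim (fun k => (u k).re) (fun k => (u k).im) k) *
      (Sum.elim (fun k => (v k).re) (fun k => (v k).im) k) := by
  simp only [PiLp.inner_apply, Complex.re_sum, RCLike.inner_apply, Fintype.sum_sum_type,
    Sum.elim_inl, Sum.elim_inr, ← Finset.sum_add_distrib]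
  refine Finset.sum_congr rfl fun k _ => ?_
  simp
  ring

lemma aux_normsq {K : Type*} [Fintype K] (u : EuclideanSpace ℂ K) :
    ∑ k : K ⊕ K, (Sum.elim (fun k => (u k).re) (fun k => (u k).im) k) ^ 2 = ‖u‖ ^ 2 := by
  rw [← inner_self_eq_norm_sq (𝕜 := ℂ) u]
  refine Eq.trans ?_ (aux_inner u u).symm
  exact Finset.sum_congr rfl fun k _ => pow_two _

lemma aux_cplx {α K : Type*} [Fintype α] [DecidableEq α] [Fintype K]
    (A : Matrix α α ℝ) (u v : α → EuclideanSpace ℂ K) :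
    ∑ x, ∑ y, A x y * (inner ℂ (u x) (v y)).re ≤
      specNorm A * (Real.sqrt (∑ x, ‖u x‖ ^ 2) * Real.sqrt (∑ y, ‖v y‖ ^ 2)) := by
  have h := aux_bilin_sum (K := K ⊕ K) A
    (fun x => Sum.elim (fun k => (u x k).re) (fun k => (u x k).im))
    (fun x => Sum.elim (fun k => (v x k).re) (fun k => (v x k).im))
  simp only [aux_normsq, ← aux_inner] at h
  exact h

/-- Block of a state at query register value `i`. -/
def blk {m n : ℕ} {W : Type} (i : Fin (n + 1)) (u : QSpace m n W) :
    EuclideanSpace ℂ (ZMod m × W) :=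
  WithLp.toLp 2 fun k => u (k.1, i, k.2)

lemma blk_inner {m n : ℕ} [NeZero m] {W : Type} [Fintype W] (u v : QSpace m n W) :
    (inner ℂ u v).re = ∑ i, (inner ℂ (blk i u) (blk i v)).re := by
  simp only [PiLp.inner_apply, blk, Complex.re_sum, Fintype.sum_prod_type]
  rw [Finset.sum_comm]

lemma blk_normsq {m n : ℕ} [NeZero m] {W : Type} [Fintype W] (u : QSpace m n W) :
    ∑ j : Fin n, ‖blk j.succ u‖ ^ 2 ≤ ‖u‖ ^ 2 := by
  have h : ‖u‖ ^ 2 = ∑ i, ‖blk i u‖ ^ 2 := by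
    have h := blk_inner u u
    have e1 := inner_self_eq_norm_sq (𝕜 := ℂ) u
    have e2 : ∀ i, (inner ℂ (blk i u) (blk i u)).re = ‖blk i u‖ ^ 2 :=
      fun i => inner_self_eq_norm_sq (𝕜 := ℂ) (blk i u)
    rw [← e1]
    simp only [e2] at h
    exact h
  rw [h, Fin.sum_univ_succ]
  have := sq_nonneg ‖blk 0 u‖
  linarith

lemma blk_oracle {m n : ℕ} [NeZero m] {W : Type} [Fintype W] (x y : Fin n → ZMod m)
    (i : Fin (n + 1)) (hxy : xExt x i = xExt y i) (u v : QSpace m n W) :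
    (inner ℂ (blk i (oracle m n W x u)) (blk i (oracle m n W y v))).re =
      (inner ℂ (blk i u) (blk i v)).re := by
  have e : ∀ (z : Fin n → ZMod m) (w : QSpace m n W) (k : ZMod m × W),
      blk i (oracle m n W z w) k = w (k.1 - xExt z i, i, k.2) := by
    intro z w k
    simp [blk, oracle, oracleEquiv, LinearIsometryEquiv.piLpCongrLeft_apply,
      Equiv.piCongrLeft'_apply]
  simp only [PiLp.inner_apply, e, hxy]
  congr 1
  rw [Fintype.sum_prod_type, Fintype.sum_prod_type]
  exact Fintype.sum_equiv (Equiv.subRight (xExt y i)) _ _ fun a => rfl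

lemma aux_blocks {m n : ℕ} [NeZero m] {W : Type} [Fintype W]
    {Dset : Finset (Fin n → ZMod m)}
    (Γ : Fin n → Matrix {x // x ∈ Dset} {x // x ∈ Dset} ℝ) (M : ℝ)
    (hM0 : 0 ≤ M) (hM : ∀ j, specNorm (Γ j) ≤ M)
    (u v : {x // x ∈ Dset} → QSpace m n W)
    (hu : ∑ x, ‖u x‖ ^ 2 ≤ 1) (hv : ∑ x, ‖v x‖ ^ 2 ≤ 1) :
    ∑ j : Fin n, ∑ x, ∑ y, Γ j x y * (inner ℂ (blk j.succ (u x)) (blk j.succ (v y))).re ≤ M := by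
  have key : ∀ w : {x // x ∈ Dset} → QSpace m n W, ∑ x, ‖w x‖ ^ 2 ≤ 1 →
      Real.sqrt (∑ j : Fin n, Real.sqrt (∑ x, ‖blk j.succ (w x)‖ ^ 2) ^ 2) ≤ 1 := by
    intro w hw
    rw [Real.sqrt_le_one]
    have : ∀ j : Fin n, Real.sqrt (∑ x, ‖blk j.succ (w x)‖ ^ 2) ^ 2
        = ∑ x, ‖blk j.succ (w x)‖ ^ 2 := fun j =>
      Real.sq_sqrt (Finset.sum_nonneg fun x _ => sq_nonneg _)
    simp only [this]
    rw [Finset.sum_comm]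
    exact (Finset.sum_le_sum fun x _ => blk_normsq (w x)).trans hw
  calc _ ≤ ∑ j : Fin n, M * (Real.sqrt (∑ x, ‖blk j.succ (u x)‖ ^ 2) *
          Real.sqrt (∑ x, ‖blk j.succ (v x)‖ ^ 2)) := by
        refine Finset.sum_le_sum fun j _ => ?_
        refine (aux_cplx (Γ j) _ _).trans ?_
        exact mul_le_mul_of_nonneg_right (hM j) (by positivity)
    _ ≤ M * 1 := by
        rw [← Finset.mul_sum]
        refine mul_le_mul_of_nonneg_left ?_ hM0
        refine (Real.sum_mul_le_sqrt_mul_sqrt _ _ _).trans ?_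
        exact mul_le_one₀ (key u hu) (Real.sqrt_nonneg _) (key v hv)
    _ = M := mul_one M

lemma aux_step {m n : ℕ} [NeZero m] {W : Type} [Fintype W]
    {Dset : Finset (Fin n → ZMod m)}
    (Γ : Matrix {x // x ∈ Dset} {x // x ∈ Dset} ℝ) (M : ℝ) (hM0 : 0 ≤ M)
    (hM : ∀ j, specNorm (Matrix.of fun x y :  {x // x ∈ Dset} =>
              Γ x y * (if x.val j ≠ y.val j then 1 else 0)) ≤ M)
    (u v : {x // x ∈ Dset} → QSpace m n W)
    (hu : ∑ x, ‖u x‖ ^ 2 ≤ 1) (hv : ∑ x, ‖v x‖ ^ 2 ≤ 1) :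
    ∑ x, ∑ y, Γ x y * (inner ℂ (u x) (v y)).re ≤
    ∑ x, ∑ y, Γ x y * (inner ℂ (oracle m n W x.val (u x)) (oracle m n W y.val (v y))).re
      + 2 * M := by
  have h1 := aux_blocks _ M hM0 hM u v hu hv
  have h2 := aux_blocks _ M hM0 hM (fun x => oracle m n W x.val (-(u x)))
    (fun x => oracle m n W x.val (v x)) (by simpa using hu) (by simpa using hv)
  have bneg : ∀ (i : Fin (n + 1)) (w : QSpace m n W), blk i (-w) = - blk i w := by
    intro i w; ext k; simp [blk]
  have key : ∑ x, ∑ y, Γ x y * (inner ℂ (u x) (v y)).re -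
    ∑ x, ∑ y, Γ x y * (inner ℂ (oracle m n W x.val (u x)) (oracle m n W y.val (v y))).re
     = (∑ j : Fin n, ∑ x, ∑ y, (Matrix.of fun x y :  {x // x ∈ Dset} =>
              Γ x y * (if x.val j ≠ y.val j then 1 else 0)) x y *
              (inner ℂ (blk j.succ (u x)) (blk j.succ (v y))).re) +
      ∑ j : Fin n, ∑ x, ∑ y, (Matrix.of fun x y :  {x // x ∈ Dset} =>
              Γ x y * (if x.val j ≠ y.val j then 1 else 0)) x y *
              (inner ℂ (blk j.succ (oracle m n W x.val (-(u x))))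
                (blk j.succ (oracle m n W y.val (v y)))).re := by
    rw [← Finset.sum_add_distrib, ← Finset.sum_sub_distrib]
    simp only [← Finset.sum_sub_distrib, ← Finset.sum_add_distrib]
    rw [Finset.sum_comm (s := (Finset.univ : Finset (Fin n)))]
    refine Finset.sum_congr rfl fun x _ => ?_
    rw [Finset.sum_comm (s := (Finset.univ : Finset (Fin n)))]
    refine Finset.sum_congr rfl fun y _ => ?_
    rw [blk_inner (u x), blk_inner (oracle m n W x.val (u x)), Fin.sum_univ_succ,
      Fin.sum_univ_succ, blk_oracle x.val y.val 0 rfl, ← mul_sub, add_sub_add_left_eq_sub,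
      ← Finset.sum_sub_distrib, Finset.mul_sum]
    refine Finset.sum_congr rfl fun j _ => ?_
    rw [map_neg, bneg, inner_neg_left, Complex.neg_re, Matrix.of_apply]
    by_cases hxy : x.val j = y.val j
    · rw [blk_oracle x.val y.val j.succ (by simpa [xExt] using hxy)]
      simp [hxy]
    · rw [if_pos hxy]
      ring
  linarith

lemma stateAfter_norm (m n : ℕ) [NeZero m] (W : Type) [Fintype W]
    (U : ℕ → QSpace m n W ≃ₗᵢ[ℂ] QSpace m n W)
    (Ox : QSpace m n W ≃ₗᵢ[ℂ] QSpace m n W) (ψ0 : QSpace m n W) (t : ℕ) :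
    ‖stateAfter m n W U Ox ψ0 t‖ = ‖ψ0‖ := by
  induction t with
  | zero => simp [stateAfter]
  | succ t ih => simp [stateAfter, ih]

lemma aux_proj {E : Type*} [NormedAddCommGroup E] [InnerProductSpace ℂ E] [CompleteSpace E]
    (P : E →L[ℂ] E) (hsa : IsSelfAdjoint P) (hid : P.comp P = P) (u v : E) :
    inner ℂ (P u) (P v) = inner ℂ u (P v) := by
  have h := ContinuousLinearMap.adjoint_inner_left P (P v) u
  rw [ContinuousLinearMap.isSelfAdjoint_iff'.mp hsa] at h
  rw [h]
  congr 1
  exact DFunLike.congr_fun hid v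

/-- Fix `m ≥ 2`, `n ≥ 1`, a finite set `W`, and `T ≥ 0`.  Let
`D ⊆ (ℤ/mℤ)ⁿ` be finite, `P, Q` probability distributions on `D`, and let
`U_0, …, U_T` be unitaries on `H`; for `x ∈ D` set
`ψ_x = U_T O_x ⋯ U_1 O_x U_0 |0⟩`.  Let `Π₀, Π₁` be orthogonal projections with
`Π₀ + Π₁ = I`, and set `s_P = ∑_{x∈D} p_x ‖Π₁ ψ_x‖²`, `s_Q = ∑ q_y ‖Π₁ ψ_y‖²`.
Then for every real `D × D` matrix `Γ`:
`δ_Pᵀ Γ δ_Q ≤ τ(s_P,s_Q) ‖Γ‖ + 2T max_j ‖Γ ∘ Δ_j‖`. -/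
theorem stmt1 (m n T : ℕ) [NeZero m] (hm : 2 ≤ m) (hn : 1 ≤ n)
    (W : Type) [Fintype W] [DecidableEq W]
    (Dset : Finset (Fin n → ZMod m))
    (p q : {x // x ∈ Dset} → ℝ)
    (hp0 : ∀ x, 0 ≤ p x) (hp1 : ∑ x, p x = 1)
    (hq0 : ∀ y, 0 ≤ q y) (hq1 : ∑ y, q y = 1)
    (U : ℕ → QSpace m n W ≃ₗᵢ[ℂ] QSpace m n W)
    (e0 : QIdx m n W)
    (P0 P1 : QSpace m n W →L[ℂ] QSpace m n W)
    (hP0sa : IsSelfAdjoint P0) (hP0idem : P0.comp P0 = P0)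
    (hP1sa : IsSelfAdjoint P1) (hP1idem : P1.comp P1 = P1)
    (hPsum : P0 + P1 = 1)
    (Γ : Matrix {x // x ∈ Dset} {x // x ∈ Dset} ℝ) :
    letI ψ : {x // x ∈ Dset} → QSpace m n W := fun x =>
      stateAfter m n W U (oracle m n W x.val) (EuclideanSpace.single e0 1) T
    letI sP : ℝ := ∑ x, p x * ‖P1 (ψ x)‖ ^ 2
    letI sQ : ℝ := ∑ y, q y * ‖P1 (ψ y)‖ ^ 2
    ∑ x, ∑ y, Real.sqrt (p x) * Γ x y * Real.sqrt (q y)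
      ≤ (Real.sqrt (sP * sQ) + Real.sqrt ((1 - sP) * (1 - sQ))) * specNorm Γ
        + 2 * T * (Finset.univ.sup' ⟨(⟨0, hn⟩ : Fin n), Finset.mem_univ _⟩
            fun j : Fin n => specNorm (Matrix.of fun x y :  {x // x ∈ Dset} =>
              Γ x y * (if x.val j ≠ y.val j then 1 else 0))) := by
  set ψ : {x // x ∈ Dset} → QSpace m n W := fun x =>
      stateAfter m n W U (oracle m n W x.val) (EuclideanSpace.single e0 1) T with hψ
  set sP : ℝ := ∑ x, p x * ‖P1 (ψ x)‖ ^ 2 with hsP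
  set sQ : ℝ := ∑ y, q y * ‖P1 (ψ y)‖ ^ 2 with hsQ
  set M := (Finset.univ.sup' ⟨(⟨0, hn⟩ : Fin n), Finset.mem_univ _⟩
            fun j : Fin n => specNorm (Matrix.of fun x y :  {x // x ∈ Dset} =>
              Γ x y * (if x.val j ≠ y.val j then 1 else 0))) with hMdef
  have hM : ∀ j, specNorm (Matrix.of fun x y :  {x // x ∈ Dset} =>
              Γ x y * (if x.val j ≠ y.val j then 1 else 0)) ≤ M := fun j =>
    Finset.le_sup' (fun j : Fin n => specNorm (Matrix.of fun x y :  {x // x ∈ Dset} =>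
              Γ x y * (if x.val j ≠ y.val j then 1 else 0))) (Finset.mem_univ j)
  have hM0 : 0 ≤ M := le_trans (norm_nonneg _) (hM ⟨0, hn⟩)
  let φ : ℕ → {x // x ∈ Dset} → QSpace m n W := fun t x =>
      stateAfter m n W U (oracle m n W x.val) (EuclideanSpace.single e0 1) t
  have hφ : ∀ t x, ‖φ t x‖ = 1 := fun t x => by
    simp [φ, stateAfter_norm]
  have hsm : ∀ (r : {x // x ∈ Dset} → ℝ) (_ : ∀ x, 0 ≤ r x)
      (g : {x // x ∈ Dset} → QSpace m n W),
      ∑ x, ‖((Real.sqrt (r x) : ℝ) : ℂ) • g x‖ ^ 2 = ∑ x, r x * ‖g x‖ ^ 2 := by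
    intro r hr g
    refine Finset.sum_congr rfl fun x _ => ?_
    rw [norm_smul, mul_pow, Complex.norm_real, Real.norm_eq_abs, sq_abs, Real.sq_sqrt (hr x)]
  have hin : ∀ (a b : ℝ) (f g : QSpace m n W),
      (inner ℂ ((a : ℂ) • f) ((b : ℂ) • g)).re = a * b * (inner ℂ f g).re := by
    intro a b f g
    rw [inner_smul_left, inner_smul_right, Complex.conj_ofReal, Complex.re_ofReal_mul,
      Complex.re_ofReal_mul, mul_assoc]
  let G : ℕ → ℝ := fun t => ∑ x, ∑ y, Γ x y *
    (inner ℂ (((Real.sqrt (p x) : ℝ) : ℂ) • φ t x) (((Real.sqrt (q y) : ℝ) : ℂ) • φ t y)).re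
  have hstep : ∀ t, G t ≤ G (t + 1) + 2 * M := by
    intro t
    have h := aux_step Γ M hM0 hM (fun x => ((Real.sqrt (p x) : ℝ) : ℂ) • φ t x)
      (fun y => ((Real.sqrt (q y) : ℝ) : ℂ) • φ t y)
      (by rw [hsm p hp0]; simp only [hφ, one_pow, mul_one]; exact hp1.le) (by rw [hsm q hq0]; simp only [hφ, one_pow, mul_one]; exact hq1.le)
    refine h.trans (le_of_eq ?_)
    congr 1
    refine Finset.sum_congr rfl fun x _ => Finset.sum_congr rfl fun y _ => ?_
    rw [map_smul, map_smul, hin, hin]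
    simp only [φ, stateAfter, LinearIsometryEquiv.inner_map_map]
  have hG0 : G 0 = ∑ x, ∑ y, Real.sqrt (p x) * Γ x y * Real.sqrt (q y) := by
    refine Finset.sum_congr rfl fun x _ => Finset.sum_congr rfl fun y _ => ?_
    rw [hin]
    have h1 : (inner ℂ (φ 0 x) (φ 0 y)).re = 1 := by
      have h2 : φ 0 x = φ 0 y := rfl
      have h3 : (inner ℂ (φ 0 y) (φ 0 y)).re = ‖φ 0 y‖ ^ 2 :=
        inner_self_eq_norm_sq (𝕜 := ℂ) (φ 0 y)
      rw [h2, h3, hφ]; norm_num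
    rw [h1]; ring
  have hind : ∀ t : ℕ, G 0 ≤ G t + 2 * t * M := by
    intro t
    induction t with
    | zero => simp
    | succ t ih =>
      have := hstep t
      push_cast
      linarith
  have hsplit : ∀ f g : QSpace m n W,
      (inner ℂ f g).re = (inner ℂ (P1 f) (P1 g)).re + (inner ℂ (P0 f) (P0 g)).re := by
    intro f g
    rw [aux_proj P1 hP1sa hP1idem, aux_proj P0 hP0sa hP0idem, ← Complex.add_re, ← inner_add_right]
    have : P1 g + P0 g = g := by
      rw [add_comm]; exact DFunLike.congr_fun hPsum g
    rw [this]
  have hpyth : ∀ x, ‖P0 (ψ x)‖ ^ 2 = 1 - ‖P1 (ψ x)‖ ^ 2 := by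
    intro x
    have h := hsplit (ψ x) (ψ x)
    have e : ∀ f : QSpace m n W, (inner ℂ f f).re = ‖f‖ ^ 2 := fun f =>
      inner_self_eq_norm_sq (𝕜 := ℂ) f
    rw [e, e, e, hφ T x] at h
    linarith
  have h0 : ∀ r : {x // x ∈ Dset} → ℝ, ∑ x, r x = 1 →
      ∑ x, r x * ‖P0 (ψ x)‖ ^ 2 = 1 - ∑ x, r x * ‖P1 (ψ x)‖ ^ 2 := by
    intro r hr
    simp only [hpyth, mul_sub, mul_one, Finset.sum_sub_distrib, hr]
  have hnn : ∀ (r : {x // x ∈ Dset} → ℝ) (_ : ∀ x, 0 ≤ r x)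
      (g : {x // x ∈ Dset} → QSpace m n W), 0 ≤ ∑ x, r x * ‖g x‖ ^ 2 := fun r hr g =>
    Finset.sum_nonneg fun x _ => mul_nonneg (hr x) (sq_nonneg _)
  have hfin : G T ≤ (Real.sqrt (sP * sQ) + Real.sqrt ((1 - sP) * (1 - sQ))) * specNorm Γ := by
    have a1 := aux_cplx Γ (fun x => ((Real.sqrt (p x) : ℝ) : ℂ) • P1 (ψ x))
      (fun y => ((Real.sqrt (q y) : ℝ) : ℂ) • P1 (ψ y))
    have a0 := aux_cplx Γ (fun x => ((Real.sqrt (p x) : ℝ) : ℂ) • P0 (ψ x))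
      (fun y => ((Real.sqrt (q y) : ℝ) : ℂ) • P0 (ψ y))
    rw [hsm p hp0, hsm q hq0, ← Real.sqrt_mul (hnn p hp0 _)] at a1 a0
    rw [h0 p hp1, h0 q hq1] at a0
    have hs : G T = ∑ x, ∑ y, Γ x y * (inner ℂ (((Real.sqrt (p x) : ℝ) : ℂ) • P1 (ψ x))
        (((Real.sqrt (q y) : ℝ) : ℂ) • P1 (ψ y))).re +
        ∑ x, ∑ y, Γ x y * (inner ℂ (((Real.sqrt (p x) : ℝ) : ℂ) • P0 (ψ x))
        (((Real.sqrt (q y) : ℝ) : ℂ) • P0 (ψ y))).re := by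
      simp only [← Finset.sum_add_distrib]
      refine Finset.sum_congr rfl fun x _ => Finset.sum_congr rfl fun y _ => ?_
      rw [hin, hin, hin, hsplit (φ T x)]
      ring
    rw [hs]
    calc _ ≤ _ := add_le_add a1 a0
      _ = _ := by ring
  have := hind T
  rw [← hG0]
  linarith


end
end

section
/- With the $k$-SUM adversary-matrix construction: for every $k$-subset $V\subseteq\{1,\dots,n\}$ with $t=\min V$, every $S\subseteq\{1,\dots,n\}$, and every $v\in D$, one has $\sqrt{m}\,E_S^{P_V,D}\,e_v = \omega^{w v_t}\, e_{v'}$ if $\mathrm{supp}(v)=S$, and $\sqrt{m}\,E_S^{P_V,D}\,e_v=0$ otherwise; here $v'\in(\mathbb{Z}/m\mathbb{Z})^{\{1,\dots,n\}\setminus\{t\}}$ is defined by $v'_j=v_j-v_t$ for $j\in V\setminus\{t\}$ and $v'_j=v_j$ for $j\notin V$, and the equality is in $\mathbb{C}^{P_V}$ after identifying $P_V$ with $D'=(\mathbb{Z}/m\mathbb{Z})^{\{1,\dots,n\}\setminus\{t\}}$ (each $x\in D'$ extends uniquely to an element of $P_V$ via the constraint $\sum_{t'\in V}x_{t'}=w$).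 -/
noncomputable section

namespace KSum

/-- `ω = e^{2πi/m}`, a primitive `m`-th root of unity. -/
def ω (m : ℕ) : ℂ := Complex.exp (2 * Real.pi * Complex.I / m)

/-- The Fourier basis vector `e_i ∈ ℂ^{ℤ/mℤ}`: `e_i[j] = ω^{ij}/√m`. -/
def eBase (m : ℕ) [NeZero m] (i : ZMod m) : ZMod m → ℂ :=
  fun j => ω m ^ (i * j).val / Real.sqrt m

/-- The Fourier basis vector `e_v = e_{v_1} ⊗ ⋯ ⊗ e_{v_n} ∈ ℂ^D`, `D = (ℤ/mℤ)ⁿ`. -/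
def eVec {n : ℕ} (m : ℕ) [NeZero m] (v : Fin n → ZMod m) : (Fin n → ZMod m) → ℂ :=
  fun x => ∏ j, eBase m (v j) (x j)

/-- The support of `v` as a finset: `{j : v_j ≠ 0}`. -/
def suppF {n m : ℕ} (v : Fin n → ZMod m) : Finset (Fin n) :=
  Finset.univ.filter fun j => v j ≠ 0

/-- The matrix `E_S = ⊗_{j} E_{1[j∈S]}` on `ℂ^D`, where `E_0 = J_m/m` (all entries `1/m`)
and `E_1 = I_m - E_0` (entries `δ_{ab} - 1/m`). -/
def ES {n : ℕ} (m : ℕ) [NeZero m] (S : Finset (Fin n)) :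
    Matrix (Fin n → ZMod m) (Fin n → ZMod m) ℂ :=
  Matrix.of fun x y => ∏ j,
    if j ∈ S then ((if x j = y j then (1 : ℂ) else 0) - 1 / m) else (1 / m : ℂ)

/-- The coefficients `α_ℓ = (n choose k)^{-1/2} max{n^{k/(k+1)} - ℓ, 0}`. -/
def alpha (n k : ℕ) (ℓ : ℕ) : ℝ :=
  ((n.choose k : ℝ) ^ (-(1 / 2 : ℝ))) * max ((n : ℝ) ^ ((k : ℝ) / ((k : ℝ) + 1)) - ℓ) 0

/-- The set `P_V = {x ∈ D : ∑_{t∈V} x_t = w}`, as a subtype of `D`. -/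
def PV {n : ℕ} (m : ℕ) [NeZero m] (w : ZMod m) (V : Finset (Fin n)) : Type :=
  {x : Fin n → ZMod m // ∑ t ∈ V, x t = w}

instance {n m : ℕ} [NeZero m] (w : ZMod m) (V : Finset (Fin n)) : Fintype (PV m w V) :=
  Subtype.fintype _

instance {n m : ℕ} [NeZero m] (w : ZMod m) (V : Finset (Fin n)) : DecidableEq (PV m w V) :=
  Subtype.instDecidableEq

/-- The `P_V × D` matrix `G_V = √m ∑_{S : V ⊄ S} α_{|S|} E_S^{P_V,D}`, where
`E_S^{P_V,D}` is the restriction of `E_S` to rows indexed by `P_V`. -/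
def GV (n k m : ℕ) [NeZero m] (w : ZMod m) (V : Finset (Fin n)) :
    Matrix (PV m w V) (Fin n → ZMod m) ℂ :=
  Matrix.of fun x y =>
    (Real.sqrt m : ℂ) * ∑ S ∈ Finset.univ.filter (fun S : Finset (Fin n) => ¬ V ⊆ S),
      (alpha n k S.card : ℂ) * ES m S x.val y

/-- Row index type of the stacked adversary matrix `Γ`: pairs `(V, x)` where `V` is a
`k`-subset of `{1,…,n}` and `x ∈ P_V`. -/
def RowIdx (n k m : ℕ) [NeZero m] (w : ZMod m) : Type :=
  Σ V : {V : Finset (Fin n) // V.card = k}, PV m w V.val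

instance {n k m : ℕ} [NeZero m] (w : ZMod m) : Fintype (RowIdx n k m w) :=
  Sigma.instFintype

instance {n k m : ℕ} [NeZero m] (w : ZMod m) : DecidableEq (RowIdx n k m w) :=
  Sigma.instDecidableEqSigma

/-- The stacked adversary matrix `Γ` for `k`-SUM: `Γ[(V,x), y] = G_V[x, y]`. -/
def Gamma (n k m : ℕ) [NeZero m] (w : ZMod m) :
    Matrix (RowIdx n k m w) (Fin n → ZMod m) ℂ :=
  Matrix.of fun r y => GV n k m w r.1.val r.2 y

end KSum

end

namespace KSum

/-- The character form of `ω`. -/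
theorem omega_pow (m : ℕ) [NeZero m] (a : ZMod m) : ω m ^ a.val = ZMod.stdAddChar a := by
  rw [ZMod.stdAddChar_apply, ZMod.toCircle_apply, ω, ← Complex.exp_nat_mul]
  congr 1
  ring

theorem eBase_eq (m : ℕ) [NeZero m] (i j : ZMod m) :
    eBase m i j = ZMod.stdAddChar (i * j) / (Real.sqrt m : ℂ) := by
  rw [eBase, omega_pow]

theorem sum_eBase (m : ℕ) [NeZero m] (a : ZMod m) :
    ∑ y, (1 / m : ℂ) * eBase m a y = if a = 0 then (1 / Real.sqrt m : ℂ) else 0 := by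
  have hm : (m : ℂ) ≠ 0 := Nat.cast_ne_zero.mpr (NeZero.ne m)
  have h := AddChar.sum_mulShift a (ZMod.isPrimitive_stdAddChar m)
  simp only [eBase_eq]
  rw [← Finset.mul_sum, ← Finset.sum_div]
  have h2 : ∑ y : ZMod m, (ZMod.stdAddChar (a * y) : ℂ) = if a = 0 then (m : ℂ) else 0 := by
    simp only [mul_comm a]
    rw [h]
    simp [ZMod.card]
  rw [h2]
  split_ifs
  · field_simp
  · simp

theorem coord (m : ℕ) [NeZero m] (a x : ZMod m) (p : Prop) [Decidable p] :
    ∑ y, (if p then ((if x = y then (1 : ℂ) else 0) - 1 / m) else (1 / m : ℂ)) * eBase m a y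
      = if (a ≠ 0 ↔ p) then eBase m a x else 0 := by
  have h0 : eBase m 0 x = (1 / Real.sqrt m : ℂ) := by simp [eBase_eq]
  by_cases hp : p
  · simp only [hp, if_true, sub_mul, Finset.sum_sub_distrib, sum_eBase]
    by_cases ha : a = 0
    · subst ha
      simp [h0]
    · simp [ha]
  · simp only [hp, if_false, sum_eBase]
    by_cases ha : a = 0
    · subst ha
      simp [h0]
    · simp [ha]

theorem ES_apply {n : ℕ} (m : ℕ) [NeZero m] (S : Finset (Fin n)) (v x : Fin n → ZMod m) :
    ∑ y : Fin n → ZMod m, ES m S x y * eVec m v y = if suppF v = S then eVec m v x else 0 := by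
  have h1 : ∑ y : Fin n → ZMod m, ES m S x y * eVec m v y
      = ∏ j, if (v j ≠ 0 ↔ j ∈ S) then eBase m (v j) (x j) else 0 := by
    simp only [← coord]
    rw [Finset.prod_univ_sum, Fintype.piFinset_univ]
    simp only [ES, eVec, Matrix.of_apply, ← Finset.prod_mul_distrib]
  rw [h1]
  split_ifs with h
  · rw [eVec]
    refine Finset.prod_congr rfl fun j _ => ?_
    rw [if_pos]
    simp [← h, suppF]
  · have : ∃ j, ¬ (v j ≠ 0 ↔ j ∈ S) := by
      by_contra hc
      push Not at hc
      apply h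
      ext j
      simpa [suppF] using hc j
    obtain ⟨j, hj⟩ := this
    exact Finset.prod_eq_zero (Finset.mem_univ j) (if_neg hj)

theorem stdAddChar_sum {ι : Type*} (m : ℕ) [NeZero m] (s : Finset ι) (f : ι → ZMod m) :
    (ZMod.stdAddChar (∑ j ∈ s, f j) : ℂ) = ∏ j ∈ s, (ZMod.stdAddChar (f j) : ℂ) := by
  classical
  induction s using Finset.induction_on with
  | empty => simp
  | insert a s ha ih => rw [Finset.sum_insert ha, Finset.prod_insert ha, AddChar.map_add_eq_mul, ih]

theorem key {n : ℕ} (m : ℕ) [NeZero m] (w : ZMod m) (V : Finset (Fin n)) (t : Fin n)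
    (ht : t ∈ V) (v x : Fin n → ZMod m) (hx : ∑ t ∈ V, x t = w) :
    (Real.sqrt m : ℂ) * eVec m v x = ω m ^ (w * v t).val *
      ∏ j ∈ Finset.univ.erase t, eBase m (if j ∈ V then v j - v t else v j) (x j) := by
  have hm : (Real.sqrt m : ℂ) ≠ 0 := by
    have : (0 : ℝ) < m := Nat.cast_pos.mpr (NeZero.pos m)
    exact_mod_cast (Real.sqrt_pos.mpr this).ne'
  rw [eVec, ← Finset.mul_prod_erase _ _ (Finset.mem_univ t), ← mul_assoc]
  simp only [eBase_eq, omega_pow, Finset.prod_div_distrib]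
  rw [mul_div_cancel₀ _ hm, ← mul_div_assoc, ← mul_div_assoc]
  congr 1
  simp only [← stdAddChar_sum, ← AddChar.map_add_eq_mul]
  congr 1
  have e1 : ∑ j ∈ Finset.univ.erase t, (if j ∈ V then v j - v t else v j) * x j
      = ∑ j ∈ Finset.univ.erase t, v j * x j - v t * ∑ j ∈ V.erase t, x j := by
    have e2 : ∑ j ∈ V.erase t, x j = ∑ j ∈ Finset.univ.erase t, if j ∈ V then x j else 0 := by
      rw [← Finset.sum_filter]
      congr 1
      ext j
      simp
    rw [e2, Finset.mul_sum, ← Finset.sum_sub_distrib]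
    refine Finset.sum_congr rfl fun j _ => ?_
    split_ifs <;> ring
  rw [e1, ← hx, ← Finset.add_sum_erase V x ht]
  ring

end KSum

open KSum in
/-- For every `k`-subset `V ⊆ {1,…,n}` with `t = min V`, every
`S ⊆ {1,…,n}` and every `v ∈ D`:
`√m E_S^{P_V,D} e_v = ω^{w v_t} e_{v'}` if `supp(v) = S`, and `= 0` otherwise,
where `v'_j = v_j - v_t` for `j ∈ V \ {t}` and `v'_j = v_j` for `j ∉ V`, and the
equality is read in `ℂ^{P_V}` (each row `x ∈ P_V` satisfies `∑_{t'∈V} x_{t'} = w`, and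
`e_{v'}` at row `x` is `∏_{j ≠ t} e_{v'_j}(x_j)`). -/
theorem stmt6 (n k m : ℕ) (hk : 1 ≤ k) (hkn : k ≤ n) [NeZero m] (hm : 2 ≤ m)
    (w : ZMod m) (V : Finset (Fin n)) (hV : V.card = k)
    (S : Finset (Fin n)) (v : Fin n → ZMod m)
    (x : Fin n → ZMod m) (hx : ∑ t ∈ V, x t = w) :
    (Real.sqrt m : ℂ) * ∑ y : Fin n → ZMod m, ES m S x y * eVec m v y
      = if suppF v = S then
          (let t := V.min' (Finset.card_pos.mp (by omega));
            ω m ^ (w * v t).val *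
              ∏ j ∈ Finset.univ.erase t,
                eBase m (if j ∈ V then v j - v t else v j) (x j))
        else 0 := by
  rw [ES_apply]
  split_ifs with h
  · exact key m w V _ (Finset.min'_mem _ _) v x hx
  · simp
end

section
/- With the $k$-SUM adversary-matrix construction, let $\Gamma$ be the matrix obtained by stacking the blocks $G_V$ over all $k$-subsets $V$ of $\{1,\dots,n\}$ (rows indexed by pairs $(V,x)$ with $x\in P_V$, columns indexed by $D$, and $\Gamma[(V,x),y]=G_V[x,y]$). Let $u$ be the vector on the rows all of whose entries equal $\left(\binom{n}{k}m^{n-1}\right)^{-1/2}$, and let $v$ be the vector on $D$ all of whose entries equal $m^{-n/2}$ (both are unit vectors). Then $u^{\dagger}\Gamma\,v = n^{k/(k+1)}$. -/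
namespace KSum

lemma ES_rowsum {n : ℕ} (m : ℕ) [NeZero m] (S : Finset (Fin n)) (x : Fin n → ZMod m) :
    ∑ y, ES m S x y = if S = ∅ then 1 else 0 := by
  have hm : (m : ℂ) ≠ 0 := Nat.cast_ne_zero.mpr (NeZero.ne m)
  simp only [ES, Matrix.of_apply]
  rw [← Fintype.prod_sum (fun j (a : ZMod m) =>
    if j ∈ S then ((if x j = a then (1 : ℂ) else 0) - 1 / m) else (1 / m : ℂ))]
  have h : ∀ j, (∑ a : ZMod m,
      if j ∈ S then ((if x j = a then (1 : ℂ) else 0) - 1 / m) else (1 / m : ℂ))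
      = if j ∈ S then 0 else 1 := by
    intro j
    by_cases hj : j ∈ S
    · simp [hj, Finset.sum_sub_distrib, ZMod.card, hm]
    · simp [hj, ZMod.card, hm]
  simp only [h]
  split_ifs with hS
  · simp [hS]
  · obtain ⟨j, hj⟩ := Finset.nonempty_iff_ne_empty.mpr hS
    exact Finset.prod_eq_zero (Finset.mem_univ j) (by simp [hj])

lemma Gamma_rowsum (n k m : ℕ) (hk : 1 ≤ k) [NeZero m] (w : ZMod m) (r : RowIdx n k m w) :
    ∑ y, Gamma n k m w r y = (Real.sqrt m : ℂ) * (alpha n k 0 : ℂ) := by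
  simp only [Gamma, GV, Matrix.of_apply]
  rw [← Finset.mul_sum, Finset.sum_comm]
  simp only [← Finset.mul_sum, ES_rowsum]
  congr 1
  rw [Finset.sum_eq_single ∅]
  · simp
  · intro S _ hS
    simp [hS]
  · intro h
    exfalso
    apply h
    simp only [Finset.mem_filter, Finset.mem_univ, true_and]
    intro hV
    have h1 := r.1.2
    rw [Finset.subset_empty.mp hV] at h1
    simp at h1
    omega

noncomputable def shiftPV {n m : ℕ} [NeZero m] (w w' : ZMod m) (V : Finset (Fin n)) (t : Fin n)
    (ht : t ∈ V) : PV m w V ≃ PV m w' V where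
  toFun x := ⟨x.1 + Pi.single t (w' - w), by
    simp [Finset.sum_add_distrib, x.2, ht]⟩
  invFun x := ⟨x.1 + Pi.single t (w - w'), by
    simp [Finset.sum_add_distrib, x.2, ht]⟩
  left_inv x := by
    apply Subtype.ext
    simp [add_assoc, ← Pi.single_add]
  right_inv x := by
    apply Subtype.ext
    simp [add_assoc, ← Pi.single_add]

lemma card_PV {n m : ℕ} [NeZero m] (w : ZMod m) (V : Finset (Fin n)) (hV : V.Nonempty) :
    Fintype.card (PV m w V) = m ^ (n - 1) := by
  obtain ⟨t, ht⟩ := hV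
  have e := Fintype.card_congr
    (Equiv.sigmaFiberEquiv (fun x : Fin n → ZMod m => ∑ t ∈ V, x t))
  rw [Fintype.card_sigma] at e
  have h : ∀ w' : ZMod m, Fintype.card {x : Fin n → ZMod m // ∑ t ∈ V, x t = w'}
      = Fintype.card (PV m w V) := fun w' => Fintype.card_congr (shiftPV w' w V t ht)
  simp only [h] at e
  simp [ZMod.card] at e
  have hn : n ≠ 0 := by have := t.2; omega
  rw [← pow_sub_one_mul hn m, mul_comm] at e
  exact Nat.eq_of_mul_eq_mul_right (Nat.pos_of_ne_zero (NeZero.ne m)) e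

lemma card_rows (n k m : ℕ) (hk : 1 ≤ k) [NeZero m] (w : ZMod m) :
    Fintype.card (RowIdx n k m w) = n.choose k * m ^ (n - 1) := by
  have h : Fintype.card (RowIdx n k m w) =
      ∑ V : {V : Finset (Fin n) // V.card = k}, Fintype.card (PV m w V.val) :=
    Fintype.card_sigma
  rw [h, Finset.sum_congr rfl (fun V _ => card_PV w V.1
    (Finset.card_pos.mp (by have := V.2; omega)))]
  simp

end KSum

open KSum in
/-- Let `Γ` be the stacked adversary matrix (rows indexed by pairs
`(V,x)` with `V` a `k`-subset and `x ∈ P_V`, columns by `D`).  Let `u` be the unit row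
vector with all entries `((n choose k) m^{n-1})^{-1/2}` and `v` the unit column vector
with all entries `m^{-n/2}`.  Then `u† Γ v = n^{k/(k+1)}`. -/
theorem stmt8 (n k m : ℕ) (hk : 1 ≤ k) (hkn : k ≤ n) [NeZero m] (hm : 2 ≤ m)
    (w : ZMod m) :
    ∑ r : RowIdx n k m w, ∑ y : Fin n → ZMod m,
        ((((n.choose k : ℝ) * (m : ℝ) ^ (n - 1)) ^ (-(1 / 2 : ℝ)) : ℝ) : ℂ)
          * Gamma n k m w r y * (((m : ℝ) ^ (-(n : ℝ) / 2) : ℝ) : ℂ)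
      = (((n : ℝ) ^ ((k : ℝ) / ((k : ℝ) + 1)) : ℝ) : ℂ) := by
  have hC : (0 : ℝ) < n.choose k := by exact_mod_cast Nat.choose_pos hkn
  have hM : (0 : ℝ) < m := by positivity
  simp only [← Finset.sum_mul, ← Finset.mul_sum]
  simp only [Gamma_rowsum n k m hk w]
  rw [Finset.sum_const, Finset.card_univ, card_rows n k m hk w, nsmul_eq_mul]
  have hN : (0 : ℝ) ≤ (n : ℝ) ^ ((k : ℝ) / ((k : ℝ) + 1)) := by positivity
  have key : (n.choose k * m ^ (n - 1) : ℝ) *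
      ((((n.choose k : ℝ) * (m : ℝ) ^ (n - 1)) ^ (-(1 / 2 : ℝ))) *
        (Real.sqrt m * alpha n k 0)) * ((m : ℝ) ^ (-(n : ℝ) / 2))
      = (n : ℝ) ^ ((k : ℝ) / ((k : ℝ) + 1)) := by
    rw [alpha, Nat.cast_zero, sub_zero, max_eq_left hN, Real.mul_rpow hC.le (by positivity),
      ← Real.rpow_natCast (m : ℝ) (n - 1), ← Real.rpow_mul hM.le, Real.sqrt_eq_rpow,
      Nat.cast_sub (hk.trans hkn), Nat.cast_one]
    have h1 : (n.choose k : ℝ) * ((n.choose k : ℝ) ^ (-(1 / 2 : ℝ)) *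
        (n.choose k : ℝ) ^ (-(1 / 2 : ℝ))) = 1 := by
      rw [← Real.rpow_add hC]
      norm_num [Real.rpow_neg_one, hC.ne']
    have h2 : (m : ℝ) ^ ((n : ℝ) - 1) * (m : ℝ) ^ (((n : ℝ) - 1) * -(1 / 2)) *
        (m : ℝ) ^ (1 / 2 : ℝ) * (m : ℝ) ^ (-(n : ℝ) / 2) = 1 := by
      rw [← Real.rpow_add hM, ← Real.rpow_add hM, ← Real.rpow_add hM]
      ring_nf
      simp
    generalize (n : ℝ) ^ ((k : ℝ) / ((k : ℝ) + 1)) = N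
    linear_combination (N * ((m : ℝ) ^ ((n : ℝ) - 1) * (m : ℝ) ^ (((n : ℝ) - 1) * -(1 / 2)) *
        (m : ℝ) ^ (1 / 2 : ℝ) * (m : ℝ) ^ (-(n : ℝ) / 2))) * h1 + N * h2
  rw [← key]
  push_cast
  ring
end

section
/- Fix $k\ge 1$ and $c_0>0$. For each $n\ge k$ let $m_n\ge c_0\, n^{k+2/(k+1)}$ be an integer, $w_n\in\mathbb{Z}/m_n\mathbb{Z}$, and let $\mathcal{S}_n$ be a $T_n$-query quantum search algorithm for $k$-SUM on $(\mathbb{Z}/m_n\mathbb{Z})^n$ (in the concrete query model: unitaries $U_0,\dots,U_{T_n}$ interleaved with the oracle $O_x$, followed by a projective measurement whose outcomes are the $k$-subsets of $\{1,\dots,n\}$ plus a failure outcome). Let $\nu_n>0$ be the probability, averaged over inputs $x$ drawn from the planted distribution $\mathcal{P}_n$, that the measured $k$-subset $S$ satisfies $\sum_{i\in S}x_i=w_n$. If $\nu_n\cdot n^{1/(k+1)}\to\infty$ as $n\to\infty$, then there exist $c>0$ and $N$ such that $T_n \ge c\,\nu_n\, n^{k/(k+1)}$ for all $n\ge N$.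 -/
noncomputable section

/-- The point probability of `x ∈ (ℤ/mℤ)ⁿ` under the planted distribution `𝒫`:
choose a uniform `k`-subset `U`, a uniform tuple on `U` summing to `w`, and uniform
values elsewhere.  Explicitly, `𝒫(x) = #{U : |U| = k, ∑_{i∈U} x_i = w} / ((n choose k)·m^{n-1})`. -/
def plantedProb (n k m : ℕ) [NeZero m] (w : ZMod m) (x : Fin n → ZMod m) : ℝ :=
  ((Finset.univ.filter fun U : Finset (Fin n) =>
      U.card = k ∧ ∑ i ∈ U, x i = w).card : ℝ)
    / ((n.choose k : ℝ) * (m : ℝ) ^ (n - 1))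

set_option linter.unusedSectionVars false

namespace KS

section kernel
variable {ι G : Type} [Fintype ι] [DecidableEq ι] [Fintype G] [DecidableEq G]

/-- one-coordinate kernel -/
def kap (D : Finset ι) (i : ι) (u v : G) : ℂ :=
  if i ∈ D then (if u = v then 1 else 0) - (Fintype.card G : ℂ)⁻¹ else (Fintype.card G : ℂ)⁻¹

/-- product kernel -/
def K (D : Finset ι) (x x' : ι → G) : ℂ := ∏ i, kap D i (x i) (x' i)

variable {V : Type} [NormedAddCommGroup V] [InnerProductSpace ℂ V]

/-- projector on the component with support exactly `D` -/
def P (D : Finset ι) (F : (ι → G) → V) (x : ι → G) : V := ∑ x', K D x x' • F x'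

lemma K_split (D : Finset ι) (i : ι) (x x' : ι → G) :
    K D x x' = kap D i (x i) (x' i) * ∏ j ∈ Finset.univ.erase i, kap D j (x j) (x' j) := by
  rw [K, Finset.mul_prod_erase _ (fun j => kap D j (x j) (x' j)) (Finset.mem_univ i)]

lemma K_indep {D : Finset ι} {i : ι} (hi : i ∉ D) (x x' : ι → G) (y : G) :
    K D (Function.update x i y) x' = K D x x' := by
  unfold K
  refine Finset.prod_congr rfl fun j _ => ?_
  by_cases h : j = i
  · subst h; simp [kap, hi]
  · rw [Function.update_of_ne h]

lemma P_indep {D : Finset ι} {i : ι} (hi : i ∉ D) (F : (ι → G) → V) (x : ι → G) (y : G) :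
    P D F (Function.update x i y) = P D F x := by
  simp only [P, K_indep hi]

lemma K_zero [Nonempty G] {D : Finset ι} {i : ι} (hi : i ∈ D) (x x' : ι → G) :
    ∑ y, K D (Function.update x i y) x' = 0 := by
  have : ∀ y, K D (Function.update x i y) x' =
      ((if y = x' i then 1 else 0) - (Fintype.card G : ℂ)⁻¹) *
        ∏ j ∈ Finset.univ.erase i, kap D j (x j) (x' j) := by
    intro y
    rw [K_split D i]
    congr 1
    · simp [kap, hi]
    · refine Finset.prod_congr rfl fun j hj => ?_
      rw [Function.update_of_ne (Finset.ne_of_mem_erase hj)]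
  simp only [this]
  rw [← Finset.sum_mul]
  simp [Finset.sum_sub_distrib]

lemma P_zero [Nonempty G] {D : Finset ι} {i : ι} (hi : i ∈ D) (F : (ι → G) → V) (x : ι → G) :
    ∑ y, P D F (Function.update x i y) = 0 := by
  simp only [P]
  rw [Finset.sum_comm]
  simp only [← Finset.sum_smul, K_zero hi, zero_smul, Finset.sum_const_zero]

lemma K_pair {D : Finset ι} {i : ι} (hi : i ∉ D) (x x' : ι → G) (h : x' i ≠ x i) :
    K D x x' + K (insert i D) x x' = 0 := by
  rw [K_split D i, K_split (insert i D) i]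
  have : ∏ j ∈ Finset.univ.erase i, kap (insert i D) j (x j) (x' j) =
      ∏ j ∈ Finset.univ.erase i, kap D j (x j) (x' j) := by
    refine Finset.prod_congr rfl fun j hj => ?_
    simp [kap, Finset.ne_of_mem_erase hj]
  rw [this, ← add_mul]
  simp [kap, hi, h.symm]

lemma P_pair_congr {D : Finset ι} {i : ι} (hi : i ∉ D) (F F' : (ι → G) → V) (x : ι → G)
    (h : ∀ x', x' i = x i → F x' = F' x') :
    P D F x + P (insert i D) F x = P D F' x + P (insert i D) F' x := by
  simp only [P, ← Finset.sum_add_distrib, ← add_smul]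
  refine Finset.sum_congr rfl fun x' _ => ?_
  by_cases hx : x' i = x i
  · rw [h x' hx]
  · rw [K_pair hi x x' hx, zero_smul, zero_smul]

lemma K_sum (x x' : ι → G) : ∑ D, K D x x' = if x = x' then 1 else 0 := by
  have h1 : ∀ D : Finset ι, K D x x' =
      (∏ i ∈ D, ((if x i = x' i then 1 else 0) - (Fintype.card G : ℂ)⁻¹)) *
      ∏ i ∈ Finset.univ \ D, (Fintype.card G : ℂ)⁻¹ := by
    intro D
    unfold K kap
    rw [Finset.prod_ite]
    congr 1
    · refine Finset.prod_congr (by ext; simp) fun _ _ => rfl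
    · refine Finset.prod_congr (by ext; simp) fun _ _ => rfl
  simp only [h1]
  rw [← Finset.powerset_univ, ← Finset.prod_add]
  simp only [sub_add_cancel]
  rw [Finset.prod_ite_zero]
  simp [funext_iff]

lemma P_sum (F : (ι → G) → V) (x : ι → G) : ∑ D, P D F x = F x := by
  simp only [P]
  rw [Finset.sum_comm]
  simp only [← Finset.sum_smul, K_sum]
  simp

lemma P_map {V' : Type} [NormedAddCommGroup V'] [InnerProductSpace ℂ V']
    (L : V →ₗ[ℂ] V') (D : Finset ι) (F : (ι → G) → V) (x : ι → G) :
    P D (fun x => L (F x)) x = L (P D F x) := by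
  simp [P, map_sum]

lemma avg {R : Type} [AddCommMonoid R] (i : ι) (g : (ι → G) → R) :
    ∑ x : ι → G, ∑ y : G, g (Function.update x i y) = Fintype.card G • ∑ x, g x := by
  have hinv : Function.Involutive
      (fun p : (ι → G) × G => (Function.update p.1 i p.2, p.1 i)) := by
    rintro ⟨x, y⟩; simp
  have := Equiv.sum_comp hinv.toPerm (fun p : (ι → G) × G => g p.1)
  simp only [Fintype.sum_prod_type, Function.Involutive.coe_toPerm] at this
  rw [this]
  simp [Finset.sum_nsmul]

lemma cross [Nonempty G] (i : ι) (u v : (ι → G) → V)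
    (hu : ∀ x y, u (Function.update x i y) = u x)
    (hv : ∀ x, ∑ y, v (Function.update x i y) = 0) :
    ∑ x, inner ℂ (u x) (v x) = 0 := by
  have := avg i (fun x => inner ℂ (u x) (v x))
  simp only [hu, ← inner_sum, hv, inner_zero_right, Finset.sum_const_zero] at this
  simpa using this

lemma cross_P [Nonempty G] (D D' : Finset ι) (F : (ι → G) → V) (c : (ι → G) → ℝ)
    (h : ∃ i, (i ∈ D ∧ i ∉ D' ∨ i ∉ D ∧ i ∈ D') ∧
      ∀ x y, c (Function.update x i y) = c x) :
    ∑ x, (c x : ℂ) * inner ℂ (P D F x) (P D' F x) = 0 := by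
  obtain ⟨i, hi, hc⟩ := h
  have key : ∀ D D' : Finset ι, i ∉ D → i ∈ D' →
      ∑ x, (c x : ℂ) * inner ℂ (P D F x) (P D' F x) = 0 := by
    intro D D' h1 h2
    have := cross i (fun x => (c x : ℂ) • P D F x) (P D' F)
      (fun x y => by simp only [hc, P_indep h1]) (fun x => P_zero h2 F x)
    simpa [inner_smul_left] using this
  rcases hi with ⟨h1, h2⟩ | ⟨h1, h2⟩
  · have := congrArg (starRingEnd ℂ) (key D' D h2 h1)
    simpa [map_sum, inner_conj_symm] using this
  · exact key D D' h1 h2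

lemma pyth [Nonempty G] (A : Finset (Finset ι)) (F : (ι → G) → V) (c : (ι → G) → ℝ)
    (h : ∀ D ∈ A, ∀ D' ∈ A, D ≠ D' → ∃ i, (i ∈ D ∧ i ∉ D' ∨ i ∉ D ∧ i ∈ D') ∧
      ∀ x y, c (Function.update x i y) = c x) :
    ∑ x, c x * ‖∑ D ∈ A, P D F x‖ ^ 2 = ∑ D ∈ A, ∑ x, c x * ‖P D F x‖ ^ 2 := by
  apply Complex.ofReal_injective
  push_cast
  have e : ∀ v : V, ((‖v‖ : ℂ)) ^ 2 = inner ℂ v v := fun v =>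
    (inner_self_eq_norm_sq_to_K (𝕜 := ℂ) v).symm
  simp only [e, sum_inner, inner_sum, Finset.mul_sum]
  rw [Finset.sum_comm]
  refine Finset.sum_congr rfl fun D hD => ?_
  rw [Finset.sum_comm]
  refine Finset.sum_eq_single_of_mem D hD fun D' hD' hne => ?_
  exact cross_P _ _ F c (h _ hD' _ hD hne)

lemma pyth_all [Nonempty G] (F : (ι → G) → V) :
    ∑ D, ∑ x, ‖P D F x‖ ^ 2 = ∑ x, ‖F x‖ ^ 2 := by
  have := pyth Finset.univ F (fun _ => 1) (by
    intro D _ D' _ hne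
    have : ∃ i, ¬ (i ∈ D ↔ i ∈ D') := by
      by_contra hcon; push Not at hcon; exact hne (Finset.ext hcon)
    obtain ⟨i, hi⟩ := this
    exact ⟨i, by tauto, fun _ _ => rfl⟩)
  simpa [P_sum] using this.symm

/-- weighted counting bound: `h` independent of coordinate `i` -/
lemma avg_bound (i : ι) (φ : (ι → G) → Prop) [DecidablePred φ] (h : (ι → G) → ℝ)
    (hh : ∀ x y, h (Function.update x i y) = h x) (h0 : ∀ x, 0 ≤ h x) (z : ℝ)
    (hz : ∀ x, h x ≠ 0 →
      ((Finset.univ.filter fun y => φ (Function.update x i y)).card : ℝ) ≤ z) :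
    (Fintype.card G : ℝ) * ∑ x, (if φ x then h x else 0) ≤ z * ∑ x, h x := by
  have := avg i (fun x => if φ x then h x else 0)
  rw [nsmul_eq_mul] at this
  rw [← this, Finset.mul_sum]
  refine Finset.sum_le_sum fun x _ => ?_
  simp only [hh]
  rw [← Finset.sum_filter, Finset.sum_const, nsmul_eq_mul]
  by_cases hx : h x = 0
  · simp [hx]
  · exact mul_le_mul_of_nonneg_right (hz x hx) (h0 x)

end kernel

section bad
open scoped Classical
variable {ι G : Type} [Fintype ι] [DecidableEq ι] [Fintype G] [DecidableEq G] [AddCommGroup G]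

/-- the database `(D, x|_D)` contains a solution -/
def bad (k : ℕ) (w : G) (D : Finset ι) (x : ι → G) : Prop :=
  ∃ S ⊆ D, S.card = k ∧ ∑ i ∈ S, x i = w

/-- indicator -/
def ind (p : Prop) : ℝ := if p then 1 else 0

lemma bad_mono {k : ℕ} {w : G} {D D' : Finset ι} {x : ι → G} (h : D ⊆ D')
    (hb : bad k w D x) : bad k w D' x := by
  obtain ⟨S, hS, h1⟩ := hb
  exact ⟨S, hS.trans h, h1⟩

lemma sum_update_not_mem {S : Finset ι} {i : ι} (hi : i ∉ S) (x : ι → G) (y : G) :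
    ∑ j ∈ S, Function.update x i y j = ∑ j ∈ S, x j := by
  refine Finset.sum_congr rfl fun j hj => ?_
  rw [Function.update_of_ne]
  rintro rfl; exact hi hj

lemma bad_indep {k : ℕ} {w : G} {D : Finset ι} {i : ι} (hi : i ∉ D) (x : ι → G) (y : G) :
    bad k w D (Function.update x i y) ↔ bad k w D x := by
  unfold bad
  refine exists_congr fun S => ?_
  refine and_congr_right fun hS => ?_
  rw [sum_update_not_mem (fun h => hi (hS h))]

lemma bad_count (k : ℕ) (w : G) {D : Finset ι} {i : ι} (x : ι → G) :
    (Finset.univ.filter fun y : G => bad k w (insert i D) (Function.update x i y) ∧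
      ¬ bad k w D (Function.update x i y)).card ≤ D.card.choose (k - 1) := by
  rw [← Finset.card_powersetCard]
  refine le_trans (Finset.card_le_card (t := (Finset.powersetCard (k-1) D).image
    (fun S => w - ∑ j ∈ S, x j)) ?_) Finset.card_image_le
  intro y hy
  simp only [Finset.mem_filter, Finset.mem_univ, true_and] at hy
  obtain ⟨⟨S, hS, hc, hs⟩, hnb⟩ := hy
  have hiS : i ∈ S := by
    by_contra hcon
    refine hnb ⟨S, fun j hj => ?_, hc, hs⟩
    rcases Finset.mem_insert.1 (hS hj) with h | h
    · exact absurd (h ▸ hj) hcon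
    · exact h
  rw [Finset.mem_image]
  refine ⟨S.erase i, ?_, ?_⟩
  · rw [Finset.mem_powersetCard, Finset.card_erase_of_mem hiS, hc]
    refine ⟨fun j hj => ?_, rfl⟩
    have := hS (Finset.mem_of_mem_erase hj)
    exact (Finset.mem_insert.1 this).resolve_left (Finset.ne_of_mem_erase hj)
  · rw [← Finset.add_sum_erase _ _ hiS, Function.update_self,
      sum_update_not_mem (Finset.notMem_erase i S)] at hs
    rw [← hs]; abel

lemma sum_pairs {R : Type} [AddCommMonoid R] (j : ι) (φ : Finset ι → R) :
    ∑ D, φ D = ∑ D ∈ Finset.univ.filter (fun D : Finset ι => j ∉ D), (φ D + φ (insert j D)) := by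
  have h : (Finset.univ : Finset ι) = insert j (Finset.univ.erase j) := by simp
  have h2 : (Finset.univ.erase j).powerset = Finset.univ.filter (fun D : Finset ι => j ∉ D) := by
    ext D
    simp only [Finset.mem_powerset, Finset.mem_filter, Finset.mem_univ, true_and]
    constructor
    · intro h hj; simpa using h hj
    · intro h i hi; simp only [Finset.mem_erase, Finset.mem_univ, and_true]; rintro rfl; exact h hi
  rw [Finset.sum_add_distrib, ← h2, ← Finset.sum_powerset_insert (by simp), ← h,
    Finset.powerset_univ]

variable {V : Type} [NormedAddCommGroup V] [InnerProductSpace ℂ V]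

lemma pairE {D : Finset ι} {j : ι} (hj : j ∉ D) (h : (ι → G) → V) (c : (ι → G) → ℝ)
    (hc : ∀ x y, c (Function.update x j y) = c x) :
    ∑ x, c x * ‖P D h x‖ ^ 2 + ∑ x, c x * ‖P (insert j D) h x‖ ^ 2 =
      ∑ x, c x * ‖P D h x + P (insert j D) h x‖ ^ 2 := by
  have hne : D ≠ insert j D := fun e => hj (e ▸ Finset.mem_insert_self j D)
  have := pyth {D, insert j D} h c (by
    intro A hA B hB hAB
    refine ⟨j, ?_, hc⟩
    simp only [Finset.mem_insert, Finset.mem_singleton] at hA hB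
    rcases hA with rfl | rfl <;> rcases hB with rfl | rfl <;> simp_all)
  simp only [Finset.sum_pair hne] at this
  exact this.symm

lemma stepX1 (k : ℕ) (w : G) (j : ι) (g : G → (ι → G) → ℂ) :
    ∑ D, ∑ x, ∑ a, ind (bad k w (D.erase j) x) * ‖P D (fun x => g (a - x j) x) x‖ ^ 2 =
    ∑ D, ∑ x, ∑ a, ind (bad k w (D.erase j) x) * ‖P D (g a) x‖ ^ 2 := by
  rw [sum_pairs j, sum_pairs j]
  refine Finset.sum_congr rfl fun D hD => ?_
  have hj : j ∉ D := by simpa using hD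
  rw [Finset.erase_insert hj, Finset.erase_eq_of_notMem hj]
  have hc : ∀ (x : ι → G) (y : G), ind (bad k w D (Function.update x j y)) = ind (bad k w D x) :=
    fun x y => by rw [bad_indep hj]
  have key : ∀ f : G → (ι → G) → ℂ,
      ∑ x, ∑ a, ind (bad k w D x) * ‖P D (f a) x‖ ^ 2 +
      ∑ x, ∑ a, ind (bad k w D x) * ‖P (insert j D) (f a) x‖ ^ 2 =
      ∑ x, ∑ a, ind (bad k w D x) * ‖P D (f a) x + P (insert j D) (f a) x‖ ^ 2 := by
    intro f
    rw [Finset.sum_comm, Finset.sum_comm (γ := ι → G) (α := G),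
      Finset.sum_comm (γ := ι → G) (α := G), ← Finset.sum_add_distrib]
    exact Finset.sum_congr rfl fun a _ => pairE hj (f a) _ hc
  rw [key, key g]
  refine Finset.sum_congr rfl fun x _ => ?_
  rw [← Equiv.sum_comp (Equiv.subRight (x j))
    (fun a => ind (bad k w D x) * ‖P D (g a) x + P (insert j D) (g a) x‖ ^ 2)]
  refine Finset.sum_congr rfl fun a _ => ?_
  rw [P_pair_congr hj (fun x => g (a - x j) x) (g (a - x j)) x (fun x' h => by rw [h])]
  rfl

lemma stepX (k : ℕ) (w : G) (j : ι) (g : G → (ι → G) → ℂ) :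
    ∑ D, ∑ x, ∑ a, ‖if bad k w (D.erase j) x then P D (fun x => g (a - x j) x) x
      else if bad k w D x then P D (g (a - x j)) x else 0‖ ^ 2 ≤
    ∑ D, ∑ x, ∑ a, ind (bad k w D x) * ‖P D (g a) x‖ ^ 2 := by
  have e1 : ∀ (D : Finset ι) (x : ι → G) (a : G),
      ‖if bad k w (D.erase j) x then P D (fun x => g (a - x j) x) x
      else if bad k w D x then P D (g (a - x j)) x else 0‖ ^ 2 =
      ind (bad k w (D.erase j) x) * ‖P D (fun x => g (a - x j) x) x‖ ^ 2 +
      ind (¬ bad k w (D.erase j) x ∧ bad k w D x) * ‖P D (g (a - x j)) x‖ ^ 2 := by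
    intro D x a
    unfold ind
    split_ifs <;> simp_all
  have e2 : ∀ (D : Finset ι) (x : ι → G) (a : G),
      ind (bad k w D x) * ‖P D (g a) x‖ ^ 2 =
      ind (bad k w (D.erase j) x) * ‖P D (g a) x‖ ^ 2 +
      ind (¬ bad k w (D.erase j) x ∧ bad k w D x) * ‖P D (g a) x‖ ^ 2 := by
    intro D x a
    have : bad k w (D.erase j) x → bad k w D x := bad_mono (Finset.erase_subset _ _)
    unfold ind
    split_ifs <;> simp_all
  simp only [e1, e2, Finset.sum_add_distrib]
  rw [stepX1]
  refine le_of_eq ?_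
  congr 1
  refine Finset.sum_congr rfl fun D _ => Finset.sum_congr rfl fun x _ => ?_
  exact Equiv.sum_comp (Equiv.subRight (x j))
    (fun a => ind (¬ bad k w (D.erase j) x ∧ bad k w D x) * ‖P D (g a) x‖ ^ 2)

/-- generic bound used for both error terms. -/
lemma stepY0 (k : ℕ) (w : G) (j : ι) (h : (ι → G) → ℂ) (z : ℝ)
    (hz : ∀ D : Finset ι, j ∉ D → (∃ x, P D h x ≠ 0) → ((D.card.choose (k-1) : ℕ) : ℝ) ≤ z) (hz0 : 0 ≤ z) :
    (Fintype.card G : ℝ) * ∑ D, ∑ x,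
      ind (bad k w D x ∧ ¬ bad k w (D.erase j) x) * ‖P (D.erase j) h x‖ ^ 2 ≤
    z * ∑ x, ‖h x‖ ^ 2 := by
  rw [sum_pairs j, Finset.mul_sum, ← pyth_all h, sum_pairs j, Finset.mul_sum]
  refine Finset.sum_le_sum fun D hD => ?_
  have hj : j ∉ D := by simpa using hD
  rw [Finset.erase_insert hj, Finset.erase_eq_of_notMem hj]
  have h0 : ∀ x, ind (bad k w D x ∧ ¬ bad k w D x) = 0 := by intro x; simp [ind]
  simp only [h0, zero_mul, Finset.sum_const_zero, zero_add]
  have := avg_bound j (fun x => bad k w (insert j D) x ∧ ¬ bad k w D x)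
    (fun x => ‖P D h x‖ ^ 2) (fun x y => by simp only [P_indep hj]) (fun x => by positivity) z
    (fun x hx => by
      refine le_trans ?_ (hz D hj ⟨x, fun e => hx (by simp [e])⟩)
      exact_mod_cast bad_count k w (D := D) (i := j) x)
  have e : ∀ x, ind (bad k w (insert j D) x ∧ ¬ bad k w D x) * ‖P D h x‖ ^ 2 =
    if bad k w (insert j D) x ∧ ¬ bad k w D x then ‖P D h x‖ ^ 2 else 0 := by
    intro x; simp [ind]
  simp only [e]
  refine this.trans (mul_le_mul_of_nonneg_left ?_ hz0)
  simp only [le_add_iff_nonneg_right]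
  positivity

lemma mink {A : Type} [Fintype A] (X Y Z : A → ℂ) :
    √(∑ a, ‖X a + Y a - Z a‖ ^ 2) ≤
      √(∑ a, ‖X a‖ ^ 2) + √(∑ a, ‖Y a‖ ^ 2) + √(∑ a, ‖Z a‖ ^ 2) := by
  have e : ∀ f : A → ℂ, √(∑ a, ‖f a‖ ^ 2) = ‖(WithLp.toLp 2 f : EuclideanSpace ℂ A)‖ := by
    intro f; rw [EuclideanSpace.norm_eq]
  rw [e, e, e, e]
  have : (WithLp.toLp 2 (fun a => X a + Y a - Z a) : EuclideanSpace ℂ A) =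
    WithLp.toLp 2 X + WithLp.toLp 2 Y - WithLp.toLp 2 Z := by ext; simp
  rw [this]
  exact (norm_sub_le _ _).trans (add_le_add (norm_add_le _ _) le_rfl)

lemma shift_energy (j : ι) (g : G → (ι → G) → ℂ) :
    ∑ a, ∑ x, ‖g (a - x j) x‖ ^ 2 = ∑ a, ∑ x, ‖g a x‖ ^ 2 := by
  rw [Finset.sum_comm, Finset.sum_comm (γ := G)]
  refine Finset.sum_congr rfl fun x _ => ?_
  exact Equiv.sum_comp (Equiv.subRight (x j)) (fun a => ‖g a x‖ ^ 2)

end bad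

section quantum
open scoped Classical

/-- erase the queried index -/
def er {n : ℕ} (i : Fin (n + 1)) (D : Finset (Fin n)) : Finset (Fin n) :=
  Fin.cases (motive := fun _ => Finset (Fin n)) D (fun j => D.erase j) i

@[simp] lemma er_zero {n : ℕ} (D : Finset (Fin n)) : er 0 D = D := rfl
@[simp] lemma er_succ {n : ℕ} (j : Fin n) (D : Finset (Fin n)) : er j.succ D = D.erase j := rfl
@[simp] lemma xExt_zero {m n : ℕ} (x : Fin n → ZMod m) : xExt x 0 = 0 := rfl
@[simp] lemma xExt_succ {m n : ℕ} (x : Fin n → ZMod m) (j : Fin n) : xExt x j.succ = x j := rfl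

lemma deg_scalar {ι G : Type} [Fintype ι] [DecidableEq ι] [Fintype G] [DecidableEq G]
    [AddCommGroup G] (j : ι) (g : G → (ι → G) → ℂ) (t : ℕ)
    (hg : ∀ a, ∀ D : Finset ι, t < D.card → ∀ x, P D (g a) x = 0) (a : G)
    (D : Finset ι) (hD : t + 1 < D.card) (x : ι → G) :
    P D (fun x => g (a - x j) x) x = 0 := by
  set E := D.erase j with hE
  have hj : j ∉ E := Finset.notMem_erase j D
  have hEc : t < E.card := by
    have := Finset.pred_card_le_card_erase (a := j) (s := D)
    rw [← hE] at this
    omega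
  have hEc' : t < (insert j E).card := hEc.trans_le (Finset.card_le_card (Finset.subset_insert _ _))
  set h : (ι → G) → ℂ := fun x => g (a - x j) x with hh
  have hQ : ∀ x, P E h x + P (insert j E) h x = 0 := by
    intro x
    rw [P_pair_congr hj h (g (a - x j)) x (fun x' e => by simp only [hh, e]), hg _ _ hEc,
      hg _ _ hEc', add_zero]
  have h0 : ∀ x, P E h x = 0 := by
    intro x
    have h1 := P_zero (Finset.mem_insert_self j E) h x
    have h2 : ∀ y, P (insert j E) h (Function.update x j y) = - P E h x := by
      intro y
      have := hQ (Function.update x j y)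
      rw [P_indep hj] at this
      exact eq_neg_of_add_eq_zero_right this
    simp only [h2] at h1
    simpa using h1
  by_cases hjD : j ∈ D
  · have : D = insert j E := (Finset.insert_erase hjD).symm
    rw [this]
    have := hQ x
    rwa [h0, zero_add] at this
  · have : D = E := (Finset.erase_eq_of_notMem hjD).symm
    rw [this]; exact h0 x

variable {m n : ℕ} [NeZero m] {W : Type} [Fintype W]

lemma oracle_apply (x : Fin n → ZMod m) (v : QSpace m n W) (a : ZMod m) (i : Fin (n + 1)) (u : W) :
    oracle m n W x v (a, i, u) = v (a - xExt x i, i, u) := rfl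

lemma P_coord (D : Finset (Fin n)) (F : (Fin n → ZMod m) → QSpace m n W) (x : Fin n → ZMod m)
    (q : QIdx m n W) : P D F x q = P D (fun x => F x q) x := by
  exact (P_map (EuclideanSpace.proj (𝕜 := ℂ) q).toLinearMap D F x).symm

/-- the energy of the bad part -/
def Bad (k : ℕ) (w : ZMod m) (F : (Fin n → ZMod m) → QSpace m n W) : ℝ :=
  ∑ D, ∑ x, ind (bad k w D x) * ‖P D F x‖ ^ 2

lemma ind_nonneg (p : Prop) : 0 ≤ ind p := by unfold ind; split_ifs <;> simp

lemma Bad_nonneg (k : ℕ) (w : ZMod m) (F : (Fin n → ZMod m) → QSpace m n W) : 0 ≤ Bad k w F :=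
  Finset.sum_nonneg fun _ _ => Finset.sum_nonneg fun _ _ =>
    mul_nonneg (ind_nonneg _) (by positivity)

lemma norm_coord (v : QSpace m n W) : ‖v‖ ^ 2 = ∑ i, ∑ u, ∑ a, ‖v (a, i, u)‖ ^ 2 := by
  rw [EuclideanSpace.norm_sq_eq, Fintype.sum_prod_type, Finset.sum_comm, Fintype.sum_prod_type]

lemma Bad_eq (k : ℕ) (w : ZMod m) (F : (Fin n → ZMod m) → QSpace m n W) :
    Bad k w F = ∑ i, ∑ u, ∑ D, ∑ x, ∑ a,
      ind (bad k w D x) * ‖P D (fun x => F x (a, i, u)) x‖ ^ 2 := by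
  have : Bad k w F = ∑ D, ∑ x, ∑ i, ∑ u, ∑ a,
      ind (bad k w D x) * ‖P D (fun x => F x (a, i, u)) x‖ ^ 2 := by
    simp only [Bad, norm_coord, P_coord, Finset.mul_sum]
  rw [this]
  have e1 : ∀ (f : Finset (Fin n) → (Fin n → ZMod m) → Fin (n+1) → W → ℝ),
      ∑ D, ∑ x, ∑ i, ∑ u, f D x i u = ∑ i, ∑ u, ∑ D, ∑ x, f D x i u := by
    intro f
    simp only [← Fintype.sum_prod_type']
    exact Fintype.sum_equiv (⟨fun p => (p.2.2.1, p.2.2.2, p.1, p.2.1),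
      fun q => (q.2.2.1, q.2.2.2, q.1, q.2.1), fun _ => rfl, fun _ => rfl⟩ :
      (Finset (Fin n) × (Fin n → ZMod m) × Fin (n+1) × W) ≃
      (Fin (n+1) × W × Finset (Fin n) × (Fin n → ZMod m))) _ _ (fun _ => rfl)
  exact e1 _

lemma energy_eq (F : (Fin n → ZMod m) → QSpace m n W) :
    ∑ x, ‖F x‖ ^ 2 = ∑ i, ∑ u, ∑ a, ∑ x, ‖F x (a, i, u)‖ ^ 2 := by
  simp only [norm_coord]
  rw [Finset.sum_comm]
  refine Finset.sum_congr rfl fun i _ => ?_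
  rw [Finset.sum_comm]
  refine Finset.sum_congr rfl fun u _ => ?_
  rw [Finset.sum_comm]

lemma deg_step (F : (Fin n → ZMod m) → QSpace m n W) (t : ℕ)
    (hF : ∀ D : Finset (Fin n), t < D.card → ∀ x, P D F x = 0)
    (D : Finset (Fin n)) (hD : t + 1 < D.card) (x : Fin n → ZMod m) :
    P D (fun x => oracle m n W x (F x)) x = 0 := by
  ext ⟨a, i, u⟩
  rw [P_coord]
  simp only [oracle_apply]
  have hg : ∀ i a, ∀ D : Finset (Fin n), t < D.card → ∀ x, P D (fun x => F x (a, i, u)) x = 0 := by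
    intro i a D hD x
    rw [← P_coord, hF D hD]; rfl
  refine Fin.cases ?_ (fun j => ?_) i
  · simp only [xExt_zero, sub_zero]
    exact hg _ _ _ (by omega) _
  · simp only [xExt_succ]
    exact deg_scalar j (fun a x => F x (a, j.succ, u)) t (hg _) a D hD x

lemma step_Y (k : ℕ) (w : ZMod m) (j : Fin n) (g : ZMod m → (Fin n → ZMod m) → ℂ) (z : ℝ)
    (hz0 : 0 ≤ z)
    (hz : ∀ a, ∀ D : Finset (Fin n), (∃ x, P D (g a) x ≠ 0) →
      ((D.card.choose (k-1) : ℕ) : ℝ) ≤ z) :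
    (m : ℝ) * ∑ D, ∑ x, ∑ a, ‖if bad k w D x ∧ ¬ bad k w (D.erase j) x then
      P (D.erase j) (g (a - x j)) x else 0‖ ^ 2 ≤ z * ∑ a, ∑ x, ‖g a x‖ ^ 2 := by
  have e1 : ∀ (D : Finset (Fin n)) (x : Fin n → ZMod m),
      ∑ a, ‖if bad k w D x ∧ ¬ bad k w (D.erase j) x then
        P (D.erase j) (g (a - x j)) x else 0‖ ^ 2 =
      ∑ a, ind (bad k w D x ∧ ¬ bad k w (D.erase j) x) * ‖P (D.erase j) (g a) x‖ ^ 2 := by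
    intro D x
    rw [← Equiv.sum_comp (Equiv.subRight (x j))
      (fun a => ind (bad k w D x ∧ ¬ bad k w (D.erase j) x) * ‖P (D.erase j) (g a) x‖ ^ 2)]
    refine Finset.sum_congr rfl fun a _ => ?_
    unfold ind
    split_ifs <;> simp
  simp only [e1]
  have e2 : ∑ D, ∑ x, ∑ a, ind (bad k w D x ∧ ¬ bad k w (D.erase j) x) *
        ‖P (D.erase j) (g a) x‖ ^ 2 =
      ∑ a, ∑ D, ∑ x, ind (bad k w D x ∧ ¬ bad k w (D.erase j) x) *
        ‖P (D.erase j) (g a) x‖ ^ 2 := by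
    rw [Finset.sum_comm (γ := ZMod m)]
    exact Finset.sum_congr rfl fun D _ => Finset.sum_comm
  rw [e2, Finset.mul_sum, Finset.mul_sum]
  refine Finset.sum_le_sum fun a _ => ?_
  have := stepY0 k w j (g a) z (fun D _ h => hz a D h) hz0
  rwa [ZMod.card] at this

lemma step_Z (k : ℕ) (w : ZMod m) (j : Fin n) (g : ZMod m → (Fin n → ZMod m) → ℂ) (z : ℝ)
    (hz0 : 0 ≤ z)
    (hz : ∀ a, ∀ D : Finset (Fin n), (∃ x, P D (fun x => g (a - x j) x) x ≠ 0) →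
      ((D.card.choose (k-1) : ℕ) : ℝ) ≤ z) :
    (m : ℝ) * ∑ D, ∑ x, ∑ a, ‖if bad k w D x ∧ ¬ bad k w (D.erase j) x then
      P (D.erase j) (fun x => g (a - x j) x) x else 0‖ ^ 2 ≤ z * ∑ a, ∑ x, ‖g a x‖ ^ 2 := by
  have e1 : ∀ (D : Finset (Fin n)) (x : Fin n → ZMod m) (a : ZMod m),
      ‖if bad k w D x ∧ ¬ bad k w (D.erase j) x then
        P (D.erase j) (fun x => g (a - x j) x) x else 0‖ ^ 2 =
      ind (bad k w D x ∧ ¬ bad k w (D.erase j) x) *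
        ‖P (D.erase j) (fun x => g (a - x j) x) x‖ ^ 2 := by
    intro D x a
    unfold ind
    split_ifs <;> simp
  simp only [e1]
  have e2 : ∑ D, ∑ x, ∑ a, ind (bad k w D x ∧ ¬ bad k w (D.erase j) x) *
        ‖P (D.erase j) (fun x => g (a - x j) x) x‖ ^ 2 =
      ∑ a, ∑ D, ∑ x, ind (bad k w D x ∧ ¬ bad k w (D.erase j) x) *
        ‖P (D.erase j) (fun x => g (a - x j) x) x‖ ^ 2 := by
    rw [Finset.sum_comm (γ := ZMod m)]
    exact Finset.sum_congr rfl fun D _ => Finset.sum_comm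
  rw [e2, ← shift_energy j g, Finset.mul_sum, Finset.mul_sum]
  refine Finset.sum_le_sum fun a _ => ?_
  have := stepY0 k w j (fun x => g (a - x j) x) z (fun D _ h => hz a D h) hz0
  rwa [ZMod.card] at this

lemma step (k : ℕ) (w : ZMod m) (F : (Fin n → ZMod m) → QSpace m n W) (t : ℕ)
    (hF : ∀ D : Finset (Fin n), t < D.card → ∀ x, P D F x = 0) :
    √(Bad k w (fun x => oracle m n W x (F x))) ≤
      √(Bad k w F) + 2 * √((t + 1 : ℝ) ^ (k - 1) / m * ∑ x, ‖F x‖ ^ 2) := by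
  set z : ℝ := (t + 1 : ℝ) ^ (k - 1) with hzdef
  have hz0 : 0 ≤ z := by positivity
  have hm : (0 : ℝ) < m := by exact_mod_cast Nat.pos_of_ne_zero (NeZero.ne m)
  have hcard : ∀ D : Finset (Fin n), D.card ≤ t + 1 → ((D.card.choose (k-1) : ℕ) : ℝ) ≤ z := by
    intro D hD
    have : D.card.choose (k-1) ≤ (t + 1) ^ (k - 1) :=
      (Nat.choose_le_choose _ hD).trans (Nat.choose_le_pow _ _)
    rw [hzdef]; exact_mod_cast this
  let A := Fin (n+1) × W × Finset (Fin n) × (Fin n → ZMod m) × ZMod m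
  let X : A → ℂ := fun ⟨i, u, D, x, a⟩ =>
    if bad k w (er i D) x then P D (fun x => F x (a - xExt x i, i, u)) x
    else if bad k w D x then P D (fun x' => F x' (a - xExt x i, i, u)) x else 0
  let Y : A → ℂ := fun ⟨i, u, D, x, a⟩ =>
    if bad k w D x ∧ ¬ bad k w (er i D) x then
      P (er i D) (fun x' => F x' (a - xExt x i, i, u)) x else 0
  let Z : A → ℂ := fun ⟨i, u, D, x, a⟩ =>
    if bad k w D x ∧ ¬ bad k w (er i D) x then
      P (er i D) (fun x => F x (a - xExt x i, i, u)) x else 0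
  have h1 : Bad k w (fun x => oracle m n W x (F x)) = ∑ p, ‖X p + Y p - Z p‖ ^ 2 := by
    rw [Bad_eq]
    simp only [A, Fintype.sum_prod_type]
    refine Finset.sum_congr rfl fun i _ => Finset.sum_congr rfl fun u _ =>
      Finset.sum_congr rfl fun D _ => Finset.sum_congr rfl fun x _ =>
      Finset.sum_congr rfl fun a _ => ?_
    simp only [X, Y, Z, oracle_apply]
    revert i
    refine Fin.cases ?_ (fun j => ?_)
    · intro _
      simp only [er_zero, ind]
      split_ifs <;> simp_all
    · intro _
      simp only [er_succ, ind, xExt_succ]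
      by_cases hb : bad k w D x
      · by_cases hb' : bad k w (D.erase j) x
        · simp [hb, hb']
        · have hj : j ∈ D := by
            by_contra hcon
            rw [Finset.erase_eq_of_notMem hcon] at hb'
            exact hb' hb
          have := P_pair_congr (Finset.notMem_erase j D) (fun x => F x (a - x j, j.succ, u))
            (fun x' => F x' (a - x j, j.succ, u)) x (fun x' h => by simp only [h])
          rw [Finset.insert_erase hj] at this
          simp only [hb, hb', not_false_eq_true, and_self, if_true, if_false, one_mul]
          congr 2
          linear_combination this
      · have hb' : ¬ bad k w (D.erase j) x := fun h => hb (bad_mono (Finset.erase_subset _ _) h)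
        simp [hb, hb']
  have hX : ∑ p, ‖X p‖ ^ 2 ≤ Bad k w F := by
    rw [Bad_eq]
    simp only [A, Fintype.sum_prod_type]
    refine Finset.sum_le_sum fun i _ => Finset.sum_le_sum fun u _ => ?_
    simp only [X]
    revert i
    refine Fin.cases ?_ (fun j => ?_)
    · intro _
      refine le_of_eq <| Finset.sum_congr rfl fun D _ => Finset.sum_congr rfl fun x _ =>
        Finset.sum_congr rfl fun a _ => ?_
      simp only [er_zero, ind, xExt_zero, sub_zero]
      split_ifs <;> simp
    · intro _
      exact stepX k w j (fun a x => F x (a, j.succ, u))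
  have hP : ∀ i u a, ∀ D : Finset (Fin n), (∃ x, P D (fun x => F x (a, i, u)) x ≠ 0) →
      ((D.card.choose (k-1) : ℕ) : ℝ) ≤ z := by
    intro i u a D ⟨x, hx⟩
    apply hcard
    by_contra hcon
    apply hx
    rw [← P_coord, hF D (by omega)]; rfl
  have hPZ : ∀ i u a, ∀ D : Finset (Fin n),
      (∃ x, P D (fun x => F x (a - xExt x i, i, u)) x ≠ 0) →
      ((D.card.choose (k-1) : ℕ) : ℝ) ≤ z := by
    intro i u a D ⟨x, hx⟩
    apply hcard
    by_contra hcon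
    apply hx
    have := P_coord D (fun x => oracle m n W x (F x)) x (a, i, u)
    simp only [oracle_apply] at this
    rw [← this, deg_step F t hF D (by omega)]; rfl
  have hY : ∑ p, ‖Y p‖ ^ 2 ≤ z / m * ∑ x, ‖F x‖ ^ 2 := by
    rw [div_mul_eq_mul_div, le_div_iff₀' hm, energy_eq]
    simp only [A, Fintype.sum_prod_type, Finset.mul_sum (R := ℝ) (s := (Finset.univ : Finset (Fin (n+1)))),
      Finset.mul_sum (R := ℝ) (s := (Finset.univ : Finset W))]
    refine Finset.sum_le_sum fun i _ => Finset.sum_le_sum fun u _ => ?_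
    simp only [Y]
    revert i
    refine Fin.cases ?_ (fun j => ?_)
    · intro _
      simp only [er_zero, and_not_self, if_false, norm_zero]
      simp only [ne_eq, OfNat.ofNat_ne_zero, not_false_eq_true, zero_pow, Finset.sum_const_zero,
        mul_zero]
      positivity
    · intro _
      exact
        step_Y k w j (fun a x => F x (a, j.succ, u)) z hz0 (hP _ _)
  have hZ : ∑ p, ‖Z p‖ ^ 2 ≤ z / m * ∑ x, ‖F x‖ ^ 2 := by
    rw [div_mul_eq_mul_div, le_div_iff₀' hm, energy_eq]
    simp only [A, Fintype.sum_prod_type, Finset.mul_sum (R := ℝ) (s := (Finset.univ : Finset (Fin (n+1)))),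
      Finset.mul_sum (R := ℝ) (s := (Finset.univ : Finset W))]
    refine Finset.sum_le_sum fun i _ => Finset.sum_le_sum fun u _ => ?_
    simp only [Z]
    revert i
    refine Fin.cases ?_ (fun j => ?_)
    · intro _
      simp only [er_zero, and_not_self, if_false, norm_zero]
      simp only [ne_eq, OfNat.ofNat_ne_zero, not_false_eq_true, zero_pow, Finset.sum_const_zero,
        mul_zero]
      positivity
    · intro _
      exact
        step_Z k w j (fun a x => F x (a, j.succ, u)) z hz0 (hPZ j.succ u)
  rw [h1]
  refine (mink X Y Z).trans ?_
  have := Real.sqrt_le_sqrt hX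
  have := Real.sqrt_le_sqrt hY
  have := Real.sqrt_le_sqrt hZ
  linarith

end quantum

section final
open scoped Classical

section gen
variable {ι G : Type} [Fintype ι] [DecidableEq ι] [Fintype G] [DecidableEq G] [AddCommGroup G]
variable {V : Type} [NormedAddCommGroup V] [InnerProductSpace ℂ V]

lemma sum_ind {A : Type} [Fintype A] (p : A → Prop) [DecidablePred p] :
    ∑ y, ind (p y) = ((Finset.univ.filter p).card : ℝ) := by
  rw [Finset.card_filter]
  push_cast
  refine Finset.sum_congr rfl fun y _ => ?_
  unfold ind
  split_ifs <;> rfl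

lemma K_symm (D : Finset ι) (x x' : ι → G) : K D x x' = K D x' x := by
  unfold K kap
  refine Finset.prod_congr rfl fun i _ => ?_
  simp only [eq_comm]

lemma P_const {D : Finset ι} (hD : D.Nonempty) (v : V) (x : ι → G) :
    P D (fun _ => v) x = 0 := by
  obtain ⟨i, hi⟩ := hD
  have h := avg i (fun x' => K D x' x)
  simp only [K_zero hi, Finset.sum_const_zero] at h
  have h2 : ∑ x', K D x' x = 0 := by simpa using h.symm
  simp only [P, ← Finset.sum_smul]
  simp only [K_symm D x, h2, zero_smul]

lemma one_sol (S : Finset ι) (w : G) {i : ι} (hi : i ∈ S) (x : ι → G) :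
    (Finset.univ.filter fun y : G => ∑ j ∈ S, Function.update x i y j = w).card = 1 := by
  rw [Finset.card_eq_one]
  refine ⟨w - ∑ j ∈ S.erase i, x j, ?_⟩
  ext y
  simp only [Finset.mem_filter, Finset.mem_univ, true_and, Finset.mem_singleton]
  rw [← Finset.add_sum_erase _ _ hi, Function.update_self,
      sum_update_not_mem (Finset.notMem_erase i S), eq_sub_iff_add_eq]

lemma pyth_one (A : Finset (Finset ι)) (F : (ι → G) → V) :
    ∑ x, ‖∑ D ∈ A, P D F x‖ ^ 2 = ∑ D ∈ A, ∑ x, ‖P D F x‖ ^ 2 := by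
  have := pyth A F (fun _ => 1) (by
    intro D _ D' _ hne
    have : ∃ i, ¬ (i ∈ D ↔ i ∈ D') := by
      by_contra hcon; push Not at hcon; exact hne (Finset.ext hcon)
    obtain ⟨i, hi⟩ := this
    exact ⟨i, by tauto, fun _ _ => rfl⟩)
  simpa using this

lemma part_out (S : Finset ι) (hS : S.Nonempty) (w : G) (h : (ι → G) → V) :
    (Fintype.card G : ℝ) * ∑ x, ind (∑ i ∈ S, x i = w) *
      ‖∑ D ∈ Finset.univ.filter (fun D => ¬ S ⊆ D), P D h x‖ ^ 2 ≤ S.card * ∑ x, ‖h x‖ ^ 2 := by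
  obtain ⟨i0, hi0⟩ := hS
  have hp : ∀ D : Finset ι, ∃ i, i ∈ S ∧ (¬ S ⊆ D → i ∉ D) := by
    intro D
    by_cases hD : S ⊆ D
    · exact ⟨i0, hi0, fun h => absurd hD h⟩
    · obtain ⟨i, h1, h2⟩ := Finset.not_subset.1 hD
      exact ⟨i, h1, fun _ => h2⟩
  choose pick hpS hpD using hp
  set B : Finset (Finset ι) := Finset.univ.filter (fun D => ¬ S ⊆ D) with hB
  let g : ι → (ι → G) → V := fun i x => ∑ D ∈ B with pick D = i, P D h x
  have hsum : ∀ x, ∑ D ∈ B, P D h x = ∑ i ∈ S, g i x := fun x =>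
    (Finset.sum_fiberwise_of_maps_to (fun D _ => hpS D) _).symm
  have hpt : ∀ x, ‖∑ D ∈ B, P D h x‖ ^ 2 ≤ S.card * ∑ i ∈ S, ‖g i x‖ ^ 2 := by
    intro x
    rw [hsum]
    calc ‖∑ i ∈ S, g i x‖ ^ 2 ≤ (∑ i ∈ S, ‖g i x‖) ^ 2 := by
          gcongr; exact norm_sum_le _ _
      _ ≤ _ := sq_sum_le_card_mul_sum_sq
  have hgi : ∀ i ∈ S, (Fintype.card G : ℝ) * ∑ x, ind (∑ i ∈ S, x i = w) * ‖g i x‖ ^ 2 ≤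
      ∑ D ∈ B with pick D = i, ∑ x, ‖P D h x‖ ^ 2 := by
    intro i hi
    rw [← pyth_one]
    have := avg_bound i (fun x : ι → G => ∑ j ∈ S, x j = w) (fun x => ‖g i x‖ ^ 2)
      (fun x y => by
        have : g i (Function.update x i y) = g i x := by
          refine Finset.sum_congr rfl fun D hD => P_indep ?_ h x y
          rw [Finset.mem_filter, hB, Finset.mem_filter] at hD
          have := hpD D hD.1.2
          rwa [hD.2] at this
        simp only [this]) (fun x => by positivity) 1
      (fun x _ => by rw [one_sol S w hi x]; simp)
    rw [one_mul] at this
    refine le_trans (le_of_eq ?_) this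
    congr 1
    refine Finset.sum_congr rfl fun x _ => ?_
    simp [ind]
  calc (Fintype.card G : ℝ) * ∑ x, ind (∑ i ∈ S, x i = w) * ‖∑ D ∈ B, P D h x‖ ^ 2
      ≤ (Fintype.card G : ℝ) * ∑ x, ind (∑ i ∈ S, x i = w) *
          (S.card * ∑ i ∈ S, ‖g i x‖ ^ 2) := by
        gcongr with x _
        · exact ind_nonneg _
        · exact hpt x
    _ = S.card * ∑ i ∈ S, (Fintype.card G : ℝ) *
          ∑ x, ind (∑ i ∈ S, x i = w) * ‖g i x‖ ^ 2 := by
        simp only [Finset.mul_sum]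
        rw [Finset.sum_comm]
        refine Finset.sum_congr rfl fun i _ => Finset.sum_congr rfl fun x _ => ?_
        ring
    _ ≤ S.card * ∑ i ∈ S, ∑ D ∈ B with pick D = i, ∑ x, ‖P D h x‖ ^ 2 := by
        gcongr with i hi
        exact hgi i hi
    _ = S.card * ∑ D ∈ B, ∑ x, ‖P D h x‖ ^ 2 := by
        rw [Finset.sum_fiberwise_of_maps_to (fun D _ => hpS D)]
    _ ≤ S.card * ∑ x, ‖h x‖ ^ 2 := by
        rw [← pyth_all h]
        gcongr
        exact Finset.subset_univ B

lemma part_S (S : Finset ι) (hS : S.Nonempty) (w : G) (h : (ι → G) → V) :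
    ∑ x, ind (∑ i ∈ S, x i = w) * ‖h x‖ ^ 2 ≤
      2 * ∑ D ∈ Finset.univ.filter (fun D => S ⊆ D),
        ∑ x, ind (∑ i ∈ S, x i = w) * ‖P D h x‖ ^ 2 +
      2 * (S.card / Fintype.card G * ∑ x, ‖h x‖ ^ 2) := by
  have hc : (0 : ℝ) < Fintype.card G := by exact_mod_cast Fintype.card_pos
  have h1 := part_out S hS w h
  rw [mul_comm, ← le_div_iff₀ hc, mul_div_right_comm] at h1
  have h2 := pyth (Finset.univ.filter (fun D => S ⊆ D)) h
    (fun x => ind (∑ i ∈ S, x i = w)) (by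
    intro D hD D' hD' hne
    have : ∃ i, ¬ (i ∈ D ↔ i ∈ D') := by
      by_contra hcon; push Not at hcon; exact hne (Finset.ext hcon)
    obtain ⟨i, hi⟩ := this
    refine ⟨i, by tauto, fun x y => ?_⟩
    simp only [Finset.mem_filter, Finset.mem_univ, true_and] at hD hD'
    rw [sum_update_not_mem]
    intro hiS
    exact hi ⟨fun _ => hD' hiS, fun _ => hD hiS⟩)
  rw [← h2]
  refine le_trans ?_ (add_le_add le_rfl (mul_le_mul_of_nonneg_left h1 (by norm_num)))
  rw [Finset.mul_sum, Finset.mul_sum, ← Finset.sum_add_distrib]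
  refine Finset.sum_le_sum fun x _ => ?_
  have e : h x = ∑ D ∈ Finset.univ.filter (fun D => S ⊆ D), P D h x +
      ∑ D ∈ Finset.univ.filter (fun D => ¬ S ⊆ D), P D h x := by
    rw [Finset.sum_filter_add_sum_filter_not, P_sum]
  have hab : ∀ a b : V, ‖a + b‖ ^ 2 ≤ 2 * ‖a‖ ^ 2 + 2 * ‖b‖ ^ 2 := by
    intro a b
    have := norm_add_le a b
    have h3 : ‖a + b‖ ^ 2 ≤ (‖a‖ + ‖b‖) ^ 2 := by gcongr
    nlinarith [sq_nonneg (‖a‖ - ‖b‖)]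
  have := mul_le_mul_of_nonneg_left (hab _ _ |>.trans' (by rw [← e])) (ind_nonneg (∑ i ∈ S, x i = w))
  refine this.trans (le_of_eq ?_)
  ring

lemma count1 (S : Finset ι) (hS : S.Nonempty) (w : G) :
    (Fintype.card G : ℝ) * ∑ x : ι → G, ind (∑ i ∈ S, x i = w) = (Fintype.card G : ℝ) ^ Fintype.card ι := by
  obtain ⟨i, hi⟩ := hS
  have := avg i (fun x : ι → G => ind (∑ i ∈ S, x i = w))
  rw [nsmul_eq_mul] at this
  rw [← this]
  have e : ∀ x : ι → G, ∑ y, ind (∑ j ∈ S, Function.update x i y j = w) = 1 := by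
    intro x
    rw [sum_ind, one_sol S w hi x]; simp
  simp [e]

lemma count2 (S S' : Finset ι) (hc : S.card = S'.card) (hne : S ≠ S') (w : G) :
    (Fintype.card G : ℝ) * ((Fintype.card G : ℝ) * ∑ x : ι → G,
      ind (∑ i ∈ S, x i = w) * ind (∑ i ∈ S', x i = w)) = (Fintype.card G : ℝ) ^ Fintype.card ι := by
  have h1 : ¬ S ⊆ S' := fun h => hne (Finset.eq_of_subset_of_card_le h hc.ge)
  have h2 : S'.Nonempty := by
    rw [← Finset.card_pos, ← hc, Finset.card_pos]
    by_contra hcon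
    rw [Finset.not_nonempty_iff_eq_empty] at hcon
    exact h1 (by simp [hcon])
  rw [← count1 S' h2 w]
  congr 1
  obtain ⟨i, hi, hi'⟩ := Finset.not_subset.1 h1
  have := avg i (fun x : ι → G => ind (∑ i ∈ S, x i = w) * ind (∑ i ∈ S', x i = w))
  rw [nsmul_eq_mul] at this
  rw [← this]
  refine Finset.sum_congr rfl fun x _ => ?_
  simp only [sum_update_not_mem hi']
  rw [← Finset.sum_mul]
  have e : ∑ y, ind (∑ j ∈ S, Function.update x i y j = w) = 1 := by
    rw [sum_ind, one_sol S w hi x]; simp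
  rw [e, one_mul]

end gen

variable {m n : ℕ} [NeZero m] {W : Type} [Fintype W]

lemma Bad_map (k : ℕ) (w : ZMod m) (U : QSpace m n W ≃ₗᵢ[ℂ] QSpace m n W)
    (F : (Fin n → ZMod m) → QSpace m n W) : Bad k w (fun x => U (F x)) = Bad k w F := by
  unfold Bad
  refine Finset.sum_congr rfl fun D _ => Finset.sum_congr rfl fun x _ => ?_
  have := P_map U.toLinearEquiv.toLinearMap D F x
  simp only [LinearEquiv.coe_coe, LinearIsometryEquiv.coe_toLinearEquiv] at this
  rw [this, LinearIsometryEquiv.norm_map]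

section run
variable (U : ℕ → QSpace m n W ≃ₗᵢ[ℂ] QSpace m n W) (ψ : QSpace m n W)

/-- state as a function of the input -/
abbrev St (t : ℕ) (x : Fin n → ZMod m) : QSpace m n W :=
  stateAfter m n W U (oracle m n W x) ψ t

lemma St_norm (t : ℕ) (x : Fin n → ZMod m) : ‖St U ψ t x‖ = ‖ψ‖ := by
  induction t with
  | zero => simp [St, stateAfter]
  | succ t ih => simpa [St, stateAfter] using ih

lemma St_deg (t : ℕ) : ∀ D : Finset (Fin n), t < D.card → ∀ x, P D (St U ψ t) x = 0 := by
  induction t with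
  | zero =>
    intro D hD x
    exact P_const (Finset.card_pos.1 hD) _ x
  | succ t ih =>
    intro D hD x
    have h1 := deg_step _ t ih D hD x
    have := P_map (U (t+1)).toLinearEquiv.toLinearMap D
      (fun x => oracle m n W x (St U ψ t x)) x
    rw [h1, map_zero] at this
    exact this

lemma St_bad0 (k : ℕ) (hk : 1 ≤ k) (w : ZMod m) : Bad k w (St U ψ 0) = 0 := by
  unfold Bad
  refine Finset.sum_eq_zero fun D _ => Finset.sum_eq_zero fun x _ => ?_
  rcases Finset.eq_empty_or_nonempty D with h | h
  · have : ¬ bad k w D x := by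
      rintro ⟨S, hS, hc, -⟩
      have := Finset.card_le_card hS
      rw [h, Finset.card_empty] at this
      omega
    simp [ind, this]
  · rw [St_deg U ψ 0 D (Finset.card_pos.2 h) x]; simp

lemma St_bad (k : ℕ) (hk : 1 ≤ k) (w : ZMod m) (hψ : ‖ψ‖ = 1) (T t : ℕ) (ht : t ≤ T) :
    √(Bad k w (St U ψ t)) ≤ t * (2 * √((T : ℝ) ^ (k - 1) / m * (m : ℝ) ^ n)) := by
  induction t with
  | zero => rw [St_bad0 U ψ k hk w]; simp
  | succ t ih =>
    have h1 := step k w (St U ψ t) t (St_deg U ψ t)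
    have h2 : Bad k w (St U ψ (t+1)) = Bad k w (fun x => oracle m n W x (St U ψ t x)) :=
      Bad_map k w (U (t+1)) (fun x => oracle m n W x (St U ψ t x))
    have h3 : ∑ x, ‖St U ψ t x‖ ^ 2 = (m : ℝ) ^ n := by
      simp only [St_norm, hψ]; simp [ZMod.card]
    rw [h3] at h1
    have h4 : √((t + 1 : ℝ) ^ (k - 1) / m * (m : ℝ) ^ n) ≤ √((T : ℝ) ^ (k - 1) / m * (m : ℝ) ^ n) := by
      apply Real.sqrt_le_sqrt
      gcongr
      exact_mod_cast ht
    rw [h2]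
    have := ih (by omega)
    push_cast
    linarith

lemma St_bad_final (k : ℕ) (hk : 1 ≤ k) (w : ZMod m) (hψ : ‖ψ‖ = 1) (T : ℕ) :
    Bad k w (St U ψ T) ≤ 4 * (T : ℝ) ^ (k + 1) / m * (m : ℝ) ^ n := by
  have h := St_bad U ψ k hk w hψ T T le_rfl
  have h2 := pow_le_pow_left₀ (Real.sqrt_nonneg _) h 2
  rw [Real.sq_sqrt (Bad_nonneg _ _ _), mul_pow, mul_pow, Real.sq_sqrt (by positivity)] at h2
  refine h2.trans (le_of_eq ?_)
  have : k + 1 = 2 + (k - 1) := by omega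
  rw [this, pow_add]
  ring
end run

section meas
variable {H : Type} [NormedAddCommGroup H] [InnerProductSpace ℂ H] [CompleteSpace H]
variable {O : Type} [Fintype O]

lemma meas_sum (Pr : Option O → (H →L[ℂ] H)) (hsa : ∀ o, IsSelfAdjoint (Pr o))
    (hidem : ∀ o, (Pr o).comp (Pr o) = Pr o) (hsum : ∑ o, Pr o = 1) (v : H) :
    ∑ S, ‖Pr (some S) v‖ ^ 2 ≤ ‖v‖ ^ 2 := by
  have e : ∀ o, ((‖Pr o v‖ : ℂ)) ^ 2 = inner ℂ v (Pr o v) := by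
    intro o
    have h1 : inner ℂ (Pr o v) (Pr o v) = (‖Pr o v‖ : ℂ) ^ 2 :=
      inner_self_eq_norm_sq_to_K (𝕜 := ℂ) _
    have h2 : inner ℂ (Pr o v) (Pr o v) = inner ℂ v (Pr o (Pr o v)) :=
      (ContinuousLinearMap.isSelfAdjoint_iff_isSymmetric.1 (hsa o)) v (Pr o v)
    have h3 : Pr o (Pr o v) = Pr o v := congrArg (fun f => f v) (hidem o)
    rw [← h1, h2, h3]
  have tot : ∑ o, ‖Pr o v‖ ^ 2 = ‖v‖ ^ 2 := by
    apply Complex.ofReal_injective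
    push_cast
    simp only [e, ← inner_sum]
    rw [← _root_.sum_apply, hsum]
    exact inner_self_eq_norm_sq_to_K (𝕜 := ℂ) _
  rw [← tot, Fintype.sum_option]
  have : 0 ≤ ‖Pr none v‖ ^ 2 := by positivity
  linarith
end meas

lemma success (k : ℕ) (hk : 1 ≤ k) (w : ZMod m)
    (Pr : Option {S : Finset (Fin n) // S.card = k} → (QSpace m n W →L[ℂ] QSpace m n W))
    (hsa : ∀ o, IsSelfAdjoint (Pr o))
    (hidem : ∀ o, (Pr o).comp (Pr o) = Pr o) (hsum : ∑ o, Pr o = 1)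
    (F : (Fin n → ZMod m) → QSpace m n W) :
    ∑ x, ∑ S : {S : Finset (Fin n) // S.card = k},
      ind (∑ i ∈ S.val, x i = w) * ‖Pr (some S) (F x)‖ ^ 2 ≤
    2 * Bad k w F + 2 * (k / m * ∑ x, ‖F x‖ ^ 2) := by
  have hms := meas_sum Pr hsa hidem hsum
  rw [Finset.sum_comm]
  have h1 : ∀ S : {S : Finset (Fin n) // S.card = k},
      ∑ x, ind (∑ i ∈ S.val, x i = w) * ‖Pr (some S) (F x)‖ ^ 2 ≤
      2 * ∑ D, ∑ x, ind (bad k w D x) * ‖Pr (some S) (P D F x)‖ ^ 2 +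
      2 * (k / m * ∑ x, ‖Pr (some S) (F x)‖ ^ 2) := by
    intro S
    have h := part_S S.val (Finset.card_pos.1 (by rw [S.2]; omega)) w (fun x => Pr (some S) (F x))
    rw [S.2, ZMod.card] at h
    refine h.trans (add_le_add (mul_le_mul_of_nonneg_left ?_ (by norm_num)) le_rfl)
    rw [Finset.sum_filter]
    refine Finset.sum_le_sum fun D _ => ?_
    split_ifs with hSD
    · refine Finset.sum_le_sum fun x _ => ?_
      have e := P_map (Pr (some S)).toLinearMap D F x
      simp only [ContinuousLinearMap.coe_coe] at e
      rw [e]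
      refine mul_le_mul_of_nonneg_right ?_ (by positivity)
      unfold ind
      split_ifs with a b
      · exact le_rfl
      · exact absurd ⟨S.val, hSD, S.2, a⟩ b
      · norm_num
      · exact le_rfl
    · exact Finset.sum_nonneg fun x _ => mul_nonneg (ind_nonneg _) (by positivity)
  refine (Finset.sum_le_sum fun S _ => h1 S).trans ?_
  rw [Finset.sum_add_distrib, ← Finset.mul_sum, ← Finset.mul_sum, ← Finset.mul_sum]
  refine add_le_add (mul_le_mul_of_nonneg_left ?_ (by norm_num))
    (mul_le_mul_of_nonneg_left (mul_le_mul_of_nonneg_left ?_ (by positivity)) (by norm_num))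
  · unfold Bad
    rw [Finset.sum_comm]
    refine Finset.sum_le_sum fun D _ => ?_
    rw [Finset.sum_comm]
    refine Finset.sum_le_sum fun x _ => ?_
    rw [← Finset.mul_sum]
    exact mul_le_mul_of_nonneg_left (hms _) (ind_nonneg _)
  · rw [Finset.sum_comm]
    exact Finset.sum_le_sum fun x _ => hms _

end final

section planted
variable {n m : ℕ} [NeZero m]

lemma ind_sq (p : Prop) : ind p * ind p = ind p := by unfold ind; split_ifs <;> simp

/-- number of solutions -/
def Nsol (k : ℕ) (w : ZMod m) (x : Fin n → ZMod m) : ℕ :=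
  (Finset.univ.filter fun U : Finset (Fin n) => U.card = k ∧ ∑ i ∈ U, x i = w).card

lemma Nsol_eq (k : ℕ) (w : ZMod m) (x : Fin n → ZMod m) :
    (Nsol k w x : ℝ) = ∑ S ∈ Finset.powersetCard k Finset.univ, ind (∑ i ∈ S, x i = w) := by
  unfold Nsol
  have : (Finset.univ.filter fun U : Finset (Fin n) => U.card = k ∧ ∑ i ∈ U, x i = w) =
    (Finset.powersetCard k Finset.univ).filter (fun U => ∑ i ∈ U, x i = w) := by
    ext U; simp [Finset.mem_powersetCard]
  rw [this, Finset.card_filter]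
  push_cast
  refine Finset.sum_congr rfl fun y _ => ?_
  unfold ind
  split_ifs <;> rfl

lemma Nsol_sum (k : ℕ) (hk : 1 ≤ k) (w : ZMod m) :
    (m : ℝ) * ∑ x : Fin n → ZMod m, (Nsol k w x : ℝ) = n.choose k * (m : ℝ) ^ n := by
  simp only [Nsol_eq]
  rw [Finset.sum_comm, Finset.mul_sum]
  rw [Finset.sum_congr rfl (g := fun _ => (m : ℝ) ^ n)]
  · simp [Finset.card_powersetCard]
  · intro S hS
    have := count1 S (Finset.card_pos.1 (by rw [(Finset.mem_powersetCard.1 hS).2]; omega)) w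
    simpa [ZMod.card] using this

lemma Nsol_sq (k : ℕ) (w : ZMod m) :
    (m : ℝ) * (m * ∑ x : Fin n → ZMod m, ((Nsol k w x : ℝ) ^ 2 - Nsol k w x)) ≤
      (n.choose k : ℝ) ^ 2 * (m : ℝ) ^ n := by
  set A : Finset (Finset (Fin n)) := Finset.powersetCard k Finset.univ with hA
  have hAc : (A.card : ℝ) = n.choose k := by simp [hA, Finset.card_powersetCard]
  have e : ∀ x : Fin n → ZMod m, (Nsol k w x : ℝ) ^ 2 - Nsol k w x =
      ∑ S ∈ A, ∑ S' ∈ A.erase S, ind (∑ i ∈ S, x i = w) * ind (∑ i ∈ S', x i = w) := by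
    intro x
    rw [Nsol_eq, sq, Finset.sum_mul_sum, ← Finset.sum_sub_distrib]
    refine Finset.sum_congr rfl fun S hS => ?_
    rw [← Finset.add_sum_erase _ _ hS, ind_sq]
    ring
  simp only [e]
  rw [Finset.sum_comm, Finset.mul_sum, Finset.mul_sum]
  calc _ ≤ ∑ S ∈ A, (n.choose k : ℝ) * (m : ℝ) ^ n := by
        refine Finset.sum_le_sum fun S hS => ?_
        rw [Finset.sum_comm, Finset.mul_sum, Finset.mul_sum]
        calc _ = ∑ S' ∈ A.erase S, (m : ℝ) ^ n := by
              refine Finset.sum_congr rfl fun S' hS' => ?_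
              have h1 := (Finset.mem_powersetCard.1 hS).2
              have h2 := (Finset.mem_powersetCard.1 (Finset.mem_of_mem_erase hS')).2
              have := count2 S S' (by rw [h1, h2]) (Finset.ne_of_mem_erase hS').symm w
              simpa [ZMod.card] using this
          _ ≤ _ := by
              rw [Finset.sum_const, nsmul_eq_mul, ← hAc]
              gcongr
              exact Finset.erase_subset _ _
    _ = _ := by rw [Finset.sum_const, nsmul_eq_mul, hAc]; ring

lemma planted_bound (k : ℕ) (hk : 1 ≤ k) (hkn : k ≤ n) (w : ZMod m)
    (s : (Fin n → ZMod m) → ℝ) (hs0 : ∀ x, 0 ≤ s x) (hs1 : ∀ x, s x ≤ 1)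
    (hsN : ∀ x, Nsol k w x = 0 → s x = 0) :
    ∑ x, plantedProb n k m w x * s x ≤
      (m * (∑ x, s x) / (m : ℝ) ^ n) / n.choose k + n.choose k / m ∧
    ∑ x, plantedProb n k m w x * s x ≤ 1 := by
  have hm : (0 : ℝ) < m := by exact_mod_cast Nat.pos_of_ne_zero (NeZero.ne m)
  have hC : (0 : ℝ) < n.choose k := by exact_mod_cast Nat.choose_pos hkn
  have hpow : (m : ℝ) ^ n = m * (m : ℝ) ^ (n - 1) := by
    rw [← pow_succ']; congr 1; omega
  have hp : ∀ x, plantedProb n k m w x = m * Nsol k w x / (n.choose k * (m : ℝ) ^ n) := by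
    intro x
    rw [hpow]
    unfold plantedProb Nsol
    field_simp
  have hmn : (0 : ℝ) < (m : ℝ) ^ n := by positivity
  have hrw : ∑ x, plantedProb n k m w x * s x =
      (m * ∑ x, Nsol k w x * s x) / (n.choose k * (m : ℝ) ^ n) := by
    rw [Finset.mul_sum, Finset.sum_div]
    refine Finset.sum_congr rfl fun x _ => ?_
    rw [hp]; ring
  rw [hrw]
  constructor
  · have h1 : ∑ x, (Nsol k w x : ℝ) * s x ≤
        ∑ x, s x + ∑ x : Fin n → ZMod m, ((Nsol k w x : ℝ) ^ 2 - Nsol k w x) := by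
      rw [← Finset.sum_add_distrib]
      refine Finset.sum_le_sum fun x _ => ?_
      rcases Nat.eq_zero_or_pos (Nsol k w x) with h | h
      · simp [h, hsN x h]
      · have h' : (1 : ℝ) ≤ Nsol k w x := by exact_mod_cast h
        nlinarith [hs0 x, hs1 x, mul_nonneg (sub_nonneg.2 h') (sub_nonneg.2 (hs1 x)),
          mul_nonneg (sub_nonneg.2 h') (sub_nonneg.2 h')]
    have h2 := Nsol_sq (n := n) k w
    rw [div_le_iff₀ (by positivity)]
    have e : (m * (∑ x, s x) / (m : ℝ) ^ n / n.choose k + n.choose k / m) *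
        (n.choose k * (m : ℝ) ^ n) = m * (∑ x, s x) + (n.choose k : ℝ) ^ 2 * (m : ℝ) ^ n / m := by
      field_simp
    rw [e]
    have h3 : m * ∑ x : Fin n → ZMod m, ((Nsol k w x : ℝ) ^ 2 - Nsol k w x) ≤
        (n.choose k : ℝ) ^ 2 * (m : ℝ) ^ n / m := by
      rw [le_div_iff₀ hm]; linarith
    have h4 := mul_le_mul_of_nonneg_left h1 hm.le
    rw [mul_add] at h4
    linarith
  · rw [div_le_one (by positivity), ← Nsol_sum k hk w]
    gcongr with x
    have := hs1 x
    have h0 : (0 : ℝ) ≤ Nsol k w x := by positivity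
    nlinarith

lemma core {W : Type} [Fintype W] (k : ℕ) (hk : 1 ≤ k) (hkn : k ≤ n) (w : ZMod m)
    (Pr : Option {S : Finset (Fin n) // S.card = k} → (QSpace m n W →L[ℂ] QSpace m n W))
    (hsa : ∀ o, IsSelfAdjoint (Pr o))
    (hidem : ∀ o, (Pr o).comp (Pr o) = Pr o) (hsum : ∑ o, Pr o = 1)
    (U : ℕ → QSpace m n W ≃ₗᵢ[ℂ] QSpace m n W) (ψ : QSpace m n W) (hψ : ‖ψ‖ = 1) (T : ℕ)
    (ν : ℝ)
    (hν : ν = ∑ x : Fin n → ZMod m,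
        plantedProb n k m w x *
          ∑ S : {S : Finset (Fin n) // S.card = k},
            (if ∑ i ∈ S.val, x i = w then
              ‖Pr (some S) (stateAfter m n W U (oracle m n W x) ψ T)‖ ^ 2
            else 0)) :
    ν ≤ (8 * (T : ℝ) ^ (k + 1) + 2 * k) / n.choose k + n.choose k / m ∧ ν ≤ 1 := by
  have hm : (0 : ℝ) < m := by exact_mod_cast Nat.pos_of_ne_zero (NeZero.ne m)
  have hC : (0 : ℝ) < n.choose k := by exact_mod_cast Nat.choose_pos hkn
  set s : (Fin n → ZMod m) → ℝ := fun x => ∑ S : {S : Finset (Fin n) // S.card = k},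
            (if ∑ i ∈ S.val, x i = w then
              ‖Pr (some S) (stateAfter m n W U (oracle m n W x) ψ T)‖ ^ 2
            else 0) with hs
  have hs0 : ∀ x, 0 ≤ s x := fun x => Finset.sum_nonneg fun S _ => by split_ifs <;> positivity
  have hs1 : ∀ x, s x ≤ 1 := by
    intro x
    calc s x ≤ ∑ S : {S : Finset (Fin n) // S.card = k},
          ‖Pr (some S) (stateAfter m n W U (oracle m n W x) ψ T)‖ ^ 2 := by
          refine Finset.sum_le_sum fun S _ => ?_
          split_ifs
          · exact le_rfl
          · positivity
      _ ≤ ‖stateAfter m n W U (oracle m n W x) ψ T‖ ^ 2 := meas_sum Pr hsa hidem hsum _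
      _ = 1 := by
          have := St_norm U ψ T x
          rw [this, hψ]; norm_num
  have hsN : ∀ x, Nsol k w x = 0 → s x = 0 := by
    intro x hx
    refine Finset.sum_eq_zero fun S _ => ?_
    rw [if_neg]
    intro hS
    unfold Nsol at hx
    rw [Finset.card_eq_zero] at hx
    have : S.val ∈ (∅ : Finset (Finset (Fin n))) := by
      rw [← hx]; simp [S.2, hS]
    simp at this
  have hsucc : ∑ x, s x ≤ 2 * (4 * (T : ℝ) ^ (k + 1) / m * (m : ℝ) ^ n) +
      2 * (k / m * (m : ℝ) ^ n) := by
    have h1 := success k hk w Pr hsa hidem hsum (St U ψ T)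
    have h2 := St_bad_final U ψ k hk w hψ T
    have h3 : ∑ x, ‖St U ψ T x‖ ^ 2 = (m : ℝ) ^ n := by
      simp only [St_norm, hψ]; simp [ZMod.card]
    rw [h3] at h1
    have h4 : ∑ x, s x = ∑ x, ∑ S : {S : Finset (Fin n) // S.card = k},
      ind (∑ i ∈ S.val, x i = w) * ‖Pr (some S) (St U ψ T x)‖ ^ 2 := by
      refine Finset.sum_congr rfl fun x _ => Finset.sum_congr rfl fun S _ => ?_
      unfold ind
      split_ifs <;> simp
    rw [h4]
    linarith
  obtain ⟨b1, b2⟩ := planted_bound k hk hkn w s hs0 hs1 hsN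
  rw [hν]
  refine ⟨b1.trans ?_, b2⟩
  gcongr
  rw [div_le_iff₀ (by positivity)]
  refine (mul_le_mul_of_nonneg_left hsucc hm.le).trans (le_of_eq ?_)
  field_simp
  ring

end planted

end KS

lemma KS.asym (k : ℕ) (hk : 1 ≤ k) (c0 : ℝ) (hc0 : 0 < c0) (m T : ℕ → ℕ) (ν : ℕ → ℝ)
    (hmpos : ∀ n, 0 < m n)
    (hm : ∀ n, k ≤ n → c0 * (n : ℝ) ^ ((k : ℝ) + 2 / ((k : ℝ) + 1)) ≤ (m n : ℝ))
    (hνpos : ∀ n, k ≤ n → 0 < ν n)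
    (hcore : ∀ n, k ≤ n → ν n ≤ (8 * (T n : ℝ) ^ (k + 1) + 2 * k) / n.choose k +
      n.choose k / m n ∧ ν n ≤ 1)
    (hgrow : Filter.Tendsto (fun n => ν n * (n : ℝ) ^ ((1 : ℝ) / ((k : ℝ) + 1)))
      Filter.atTop Filter.atTop) :
    ∃ c : ℝ, 0 < c ∧ ∃ N : ℕ, ∀ n ≥ N,
      c * ν n * (n : ℝ) ^ ((k : ℝ) / ((k : ℝ) + 1)) ≤ (T n : ℝ) := by
  set α : ℝ := 1 / (2 ^ k * (k.factorial : ℝ)) with hα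
  have hα0 : 0 < α := by positivity
  have hα1 : α ≤ 1 := by
    rw [hα, div_le_one (by positivity)]
    have h1 : (1 : ℝ) ≤ 2 ^ k := one_le_pow₀ (by norm_num)
    have h2 : (1 : ℝ) ≤ k.factorial := by exact_mod_cast Nat.factorial_pos k
    nlinarith
  refine ⟨α / 32, by positivity, ?_⟩
  obtain ⟨N1, hN1⟩ := Filter.eventually_atTop.1 (hgrow.eventually_ge_atTop (2 / c0))
  obtain ⟨N2, hN2⟩ := Filter.eventually_atTop.1 (hgrow.eventually_ge_atTop (8 * k / α + 1))
  refine ⟨max (max N1 N2) (2 * k), fun n hn => ?_⟩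
  have hn1 := hN1 n (by omega)
  have hn2 := hN2 n (by omega)
  have hn3 : 2 * k ≤ n := by omega
  have hkn : k ≤ n := by omega
  have hnpos : 0 < n := by omega
  have hnR : (1 : ℝ) ≤ n := by exact_mod_cast hnpos
  have hnR0 : (0 : ℝ) < n := by linarith
  obtain ⟨hc, hν1⟩ := hcore n hkn
  have hν0 := hνpos n hkn
  have hC : (0 : ℝ) < n.choose k := by exact_mod_cast Nat.choose_pos hkn
  have hmR : (0 : ℝ) < m n := by exact_mod_cast hmpos n
  have hkR : (1 : ℝ) ≤ k := by exact_mod_cast hk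
  set r : ℝ := (n : ℝ) ^ ((1 : ℝ) / ((k : ℝ) + 1)) with hr
  have hr1 : 1 ≤ r := Real.one_le_rpow hnR (by positivity)
  have hr0 : 0 < r := by linarith
  have e1 : (n : ℝ) ^ ((k : ℝ) + 2 / ((k : ℝ) + 1)) = (n : ℝ) ^ k * r ^ 2 := by
    rw [Real.rpow_add hnR0, Real.rpow_natCast, hr, ← Real.rpow_natCast (_ ^ _) 2, ← Real.rpow_mul hnR0.le]
    congr 2
    push_cast; ring
  have e2 : (n : ℝ) ^ ((k : ℝ) / ((k : ℝ) + 1)) = r ^ k := by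
    rw [hr, ← Real.rpow_natCast, ← Real.rpow_mul hnR0.le]
    congr 1
    ring
  have e3 : r ^ (k + 1) = n := by
    rw [hr, ← Real.rpow_natCast, ← Real.rpow_mul hnR0.le]
    push_cast
    rw [one_div_mul_cancel (by positivity), Real.rpow_one]
  have hmn := hm n hkn
  rw [e1] at hmn
  have hCle : (n.choose k : ℝ) ≤ (n : ℝ) ^ k := by exact_mod_cast Nat.choose_le_pow n k
  have hCm : (n.choose k : ℝ) / m n ≤ ν n / 2 := by
    rw [div_le_iff₀ hmR]
    have h1 : 2 ≤ c0 * (ν n * r) := by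
      have := (div_le_iff₀ hc0).1 hn1
      linarith
    calc (n.choose k : ℝ) ≤ (n : ℝ) ^ k := hCle
      _ ≤ (n : ℝ) ^ k * (c0 * (ν n * r) / 2 * r) := by
          refine le_mul_of_one_le_right (by positivity) ?_
          nlinarith
      _ = ν n / 2 * (c0 * ((n : ℝ) ^ k * r ^ 2)) := by ring
      _ ≤ ν n / 2 * m n := by gcongr
  have h2 : ν n * n.choose k ≤ 16 * (T n : ℝ) ^ (k + 1) + 4 * k := by
    have : ν n / 2 ≤ (8 * (T n : ℝ) ^ (k + 1) + 2 * k) / n.choose k := by linarith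
    rw [le_div_iff₀ hC] at this
    linarith
  have hClow : α * (n : ℝ) ^ k ≤ n.choose k := by
    have h := Nat.pow_le_choose (α := ℝ) k n
    have h3 : (n : ℝ) / 2 ≤ ((n + 1 - k : ℕ) : ℝ) := by
      rw [div_le_iff₀ (by norm_num)]
      have : n ≤ (n + 1 - k) * 2 := by omega
      exact_mod_cast this
    have h4 : ((n : ℝ) / 2) ^ k ≤ k.factorial * n.choose k := by
      refine (pow_le_pow_left₀ (by positivity) h3 k).trans ?_
      first
      | exact h
      | (rw [div_le_iff₀' (by positivity)] at h; exact h)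
    rw [div_pow, div_le_iff₀ (by positivity)] at h4
    rw [hα, one_div, inv_mul_le_iff₀ (by positivity)]
    linarith
  rw [e2, mul_assoc]
  set L : ℝ := ν n * r ^ k with hL
  have hL0 : 0 ≤ L := by positivity
  have hLbig : 8 * k / α + 1 ≤ L := by
    refine hn2.trans ?_
    rw [hL]
    gcongr
    exact le_self_pow₀ hr1 (by omega)
  have hL1 : 1 ≤ L := by
    have : 0 ≤ 8 * k / α := by positivity
    linarith
  have hLp : L ^ (k + 1) ≤ ν n * (n : ℝ) ^ k := by
    have : L ^ (k + 1) = ν n ^ (k + 1) * (n : ℝ) ^ k := by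
      rw [hL, mul_pow, ← e3]; ring
    rw [this]
    gcongr
    exact pow_le_of_le_one hν0.le hν1 (by omega)
  have h5 : α * L ^ (k + 1) ≤ 16 * (T n : ℝ) ^ (k + 1) + 4 * k := by
    calc α * L ^ (k + 1) ≤ α * (ν n * (n : ℝ) ^ k) := by gcongr
      _ = ν n * (α * (n : ℝ) ^ k) := by ring
      _ ≤ ν n * n.choose k := by gcongr
      _ ≤ _ := h2
  have h6 : 8 * k ≤ α * L ^ (k + 1) := by
    have h7 : L ≤ L ^ (k + 1) := le_self_pow₀ hL1 (by omega)
    have h8 : 8 * k / α ≤ L ^ (k + 1) := by linarith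
    rw [div_le_iff₀ hα0] at h8
    linarith
  have h9 : α / 32 * L ^ (k + 1) ≤ (T n : ℝ) ^ (k + 1) := by linarith
  have h10 : (α / 32 * L) ^ (k + 1) ≤ (T n : ℝ) ^ (k + 1) := by
    refine le_trans ?_ h9
    rw [mul_pow]
    gcongr
    exact pow_le_of_le_one (by positivity) (by linarith) (by omega)
  exact le_of_pow_le_pow_left₀ (by omega) (by positivity) h10

/-- Fix `k ≥ 1` and `c₀ > 0`.  For each `n` let `m_n ≥ c₀ n^{k+2/(k+1)}`
(for `n ≥ k`), `w_n ∈ ℤ/m_nℤ`, and let `𝒮_n` be a `T_n`-query quantum search algorithm for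
`k`-SUM (unitaries `U_0,…,U_{T_n}` interleaved with the oracle `O_x`, followed by a
projective measurement with outcomes the `k`-subsets of `{1,…,n}` plus failure).  Let
`ν_n > 0` be the probability, averaged over inputs from the planted distribution `𝒫_n`,
that the measured `k`-subset `S` satisfies `∑_{i∈S} x_i = w_n`.  If
`ν_n · n^{1/(k+1)} → ∞`, then there are `c > 0` and `N` with
`T_n ≥ c ν_n n^{k/(k+1)}` for all `n ≥ N`. -/
theorem stmt11 (k : ℕ) (hk : 1 ≤ k) (c0 : ℝ) (hc0 : 0 < c0)
    (m : ℕ → ℕ) [∀ n, NeZero (m n)]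
    (w : ∀ n, ZMod (m n))
    (hm : ∀ n, k ≤ n → c0 * (n : ℝ) ^ ((k : ℝ) + 2 / ((k : ℝ) + 1)) ≤ (m n : ℝ))
    (T : ℕ → ℕ)
    (W : ℕ → Type) [∀ n, Fintype (W n)] [∀ n, DecidableEq (W n)]
    (U : ∀ n, ℕ → (QSpace (m n) n (W n) ≃ₗᵢ[ℂ] QSpace (m n) n (W n)))
    (e0 : ∀ n, QIdx (m n) n (W n))
    (Proj : ∀ n, Option {S : Finset (Fin n) // S.card = k} →
      (QSpace (m n) n (W n) →L[ℂ] QSpace (m n) n (W n)))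
    (hsa : ∀ n o, IsSelfAdjoint (Proj n o))
    (hidem : ∀ n o, (Proj n o).comp (Proj n o) = Proj n o)
    (horth : ∀ n o o', o ≠ o' → (Proj n o).comp (Proj n o') = 0)
    (hsum : ∀ n, ∑ o, Proj n o = 1)
    (ν : ℕ → ℝ)
    (hν : ∀ n, ν n = ∑ x : Fin n → ZMod (m n),
        plantedProb n k (m n) (w n) x *
          ∑ S : {S : Finset (Fin n) // S.card = k},
            (if ∑ i ∈ S.val, x i = w n then
              ‖Proj n (some S)
                  (stateAfter (m n) n (W n) (U n) (oracle (m n) n (W n) x)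
                    (EuclideanSpace.single (e0 n) 1) (T n))‖ ^ 2
            else 0))
    (hνpos : ∀ n, k ≤ n → 0 < ν n)
    (hgrow : Filter.Tendsto (fun n => ν n * (n : ℝ) ^ ((1 : ℝ) / ((k : ℝ) + 1)))
      Filter.atTop Filter.atTop) :
    ∃ c : ℝ, 0 < c ∧ ∃ N : ℕ, ∀ n ≥ N,
      c * ν n * (n : ℝ) ^ ((k : ℝ) / ((k : ℝ) + 1)) ≤ (T n : ℝ) := by
  have hcore : ∀ n, k ≤ n → ν n ≤ (8 * (T n : ℝ) ^ (k + 1) + 2 * k) / n.choose k +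
      n.choose k / m n ∧ ν n ≤ 1 := by
    intro n hkn
    exact KS.core k hk hkn (w n) (Proj n) (hsa n) (hidem n) (hsum n) (U n)
      (EuclideanSpace.single (e0 n) 1) (by simp) (T n) (ν n) (hν n)
  exact KS.asym k hk c0 hc0 m T ν (fun n => Nat.pos_of_ne_zero (NeZero.ne (m n))) hm hνpos
    hcore hgrow

end
end

section
/- With the bucket-composition construction: let $P_F,Q_F$ be probability distributions on $A^n$ with associated unit vectors $\delta_{P_F},\delta_{Q_F}$ (entries the square roots of the point probabilities), and let $\delta_P=\delta_{P_F}\otimes u_\ell^{\otimes n}$ and $\delta_Q=\delta_{Q_F}\otimes u_\ell^{\otimes n}$, where $u_\ell\in\mathbb{R}^{\{1,\dots,\ell\}}$ has all entries $\ell^{-1/2}$. Then $\delta_P^{\mathsf{T}}\,\Gamma_H\,\delta_Q = (\ell-1)^n\;\delta_{P_F}^{\mathsf{T}}\,\Gamma_F\,\delta_{Q_F}$. -/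
noncomputable section

namespace Bucket

variable {A : Type*} [Fintype A] [DecidableEq A]

/-- The `ℓ × ℓ` matrix `Γ̄^{a,b}`: `(ℓ-1)·I_ℓ` if `a = b`, and `𝟏_ℓ - I_ℓ` if `a ≠ b`. -/
def barGamma (ℓ : ℕ) (a b : A) : Matrix (Fin ℓ) (Fin ℓ) ℝ :=
  Matrix.of fun p q =>
    if a = b then (if p = q then (ℓ : ℝ) - 1 else 0)
    else (if p = q then 0 else 1)

/-- The bucket-composed matrix `Γ_H`, indexed by pairs `(X, r)` with `X ∈ Aⁿ` and
`r ∈ {1,…,ℓ}ⁿ` (positions of the non-`⋆` entries in the buckets):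
`Γ_H[(X,r),(Y,s)] = Γ_F[X,Y] ∏ᵢ Γ̄^{Xᵢ,Yᵢ}[rᵢ,sᵢ]`. -/
def GammaH (n ℓ : ℕ) (ΓF : Matrix (Fin n → A) (Fin n → A) ℝ) :
    Matrix ((Fin n → A) × (Fin n → Fin ℓ)) ((Fin n → A) × (Fin n → Fin ℓ)) ℝ :=
  Matrix.of fun Xr Ys =>
    ΓF Xr.1 Ys.1 * ∏ i, barGamma ℓ (Xr.1 i) (Ys.1 i) (Xr.2 i) (Ys.2 i)

end Bucket

end

open Bucket in
lemma barGamma_row_sum {A : Type*} [DecidableEq A] (ℓ : ℕ) (a b : A) (p : Fin ℓ) :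
    ∑ q, barGamma ℓ a b p q = (ℓ : ℝ) - 1 := by
  unfold barGamma
  by_cases h : a = b
  · simp [h]
  · have h2 : ∀ q : Fin ℓ, (if p = q then (0 : ℝ) else 1) = 1 - (if p = q then 1 else 0) := by
      intro q; split_ifs <;> simp
    simp only [Matrix.of_apply, h, if_false, h2, Finset.sum_sub_distrib]
    simp

open Bucket in
lemma prod_barGamma_sum {A : Type*} [DecidableEq A] (n ℓ : ℕ) (X Y : Fin n → A)
    (r : Fin n → Fin ℓ) :
    ∑ s : Fin n → Fin ℓ, ∏ i, barGamma ℓ (X i) (Y i) (r i) (s i) = ((ℓ : ℝ) - 1) ^ n := by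
  rw [← Fintype.prod_sum (fun i q => barGamma ℓ (X i) (Y i) (r i) q)]
  simp [barGamma_row_sum]

open Bucket in
/-- With the bucket-composition construction: for probability
distributions `P_F, Q_F` on `Aⁿ` with unit vectors `δ_{P_F}, δ_{Q_F}` (entries the square
roots of the point probabilities), and `δ_P = δ_{P_F} ⊗ u_ℓ^{⊗n}`,
`δ_Q = δ_{Q_F} ⊗ u_ℓ^{⊗n}` with `u_ℓ` the vector with all entries `ℓ^{-1/2}`:
`δ_Pᵀ Γ_H δ_Q = (ℓ-1)ⁿ δ_{P_F}ᵀ Γ_F δ_{Q_F}`. -/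
theorem stmt12 {A : Type*} [Fintype A] [DecidableEq A] (n ℓ : ℕ)
    (hn : 1 ≤ n) (hℓ : 1 ≤ ℓ)
    (pF qF : (Fin n → A) → ℝ)
    (hp0 : ∀ X, 0 ≤ pF X) (hp1 : ∑ X, pF X = 1)
    (hq0 : ∀ Y, 0 ≤ qF Y) (hq1 : ∑ Y, qF Y = 1)
    (ΓF : Matrix (Fin n → A) (Fin n → A) ℝ) :
    ∑ Xr : (Fin n → A) × (Fin n → Fin ℓ), ∑ Ys : (Fin n → A) × (Fin n → Fin ℓ),
        (Real.sqrt (pF Xr.1) * ((Real.sqrt ℓ)⁻¹) ^ n)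
          * GammaH n ℓ ΓF Xr Ys
          * (Real.sqrt (qF Ys.1) * ((Real.sqrt ℓ)⁻¹) ^ n)
      = ((ℓ : ℝ) - 1) ^ n *
          ∑ X : Fin n → A, ∑ Y : Fin n → A,
            Real.sqrt (pF X) * ΓF X Y * Real.sqrt (qF Y) := by
  have hl : (0 : ℝ) < ℓ := by exact_mod_cast hℓ
  have hc : ((Real.sqrt ℓ)⁻¹) ^ n * ((Real.sqrt ℓ)⁻¹) ^ n * (ℓ : ℝ) ^ n = 1 := by
    rw [← mul_pow, ← mul_pow, ← mul_inv, Real.mul_self_sqrt hl.le, inv_mul_cancel₀ hl.ne', one_pow]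
  rw [Fintype.sum_prod_type, Finset.mul_sum]
  refine Finset.sum_congr rfl fun X _ => ?_
  simp_rw [Fintype.sum_prod_type]
  rw [Finset.sum_comm, Finset.mul_sum]
  refine Finset.sum_congr rfl fun Y _ => ?_
  have h : ∀ r : Fin n → Fin ℓ, ∑ s : Fin n → Fin ℓ,
      (Real.sqrt (pF X) * ((Real.sqrt ℓ)⁻¹) ^ n) * GammaH n ℓ ΓF (X, r) (Y, s)
          * (Real.sqrt (qF Y) * ((Real.sqrt ℓ)⁻¹) ^ n)
      = (((Real.sqrt ℓ)⁻¹) ^ n * ((Real.sqrt ℓ)⁻¹) ^ n)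
        * (Real.sqrt (pF X) * ΓF X Y * Real.sqrt (qF Y)) * ((ℓ : ℝ) - 1) ^ n := by
    intro r
    rw [← prod_barGamma_sum n ℓ X Y r, Finset.mul_sum]
    refine Finset.sum_congr rfl fun s _ => ?_
    simp only [GammaH, Matrix.of_apply]
    ring
  simp_rw [h]
  rw [Finset.sum_const, Finset.card_univ, Fintype.card_fun, Fintype.card_fin, Fintype.card_fin,
    nsmul_eq_mul]
  push_cast
  linear_combination (Real.sqrt (pF X) * ΓF X Y * Real.sqrt (qF Y)) * ((ℓ : ℝ) - 1) ^ n * hc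
end
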